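/- The probability that a uniformly random simple 3-regular graph G on n labelled vertices satisfies Z(G) ≤ α(G) + 1, where α(G) is the independence number of G, tends to 1 as n → ∞ along even integers n. -/

import Mathlib

/-- One step of the zero forcing colour-change rule: some black vertex `v ∈ S`
whose unique white neighbour is `w` forces `w`, giving `T = insert w S`. -/
def zfStep {V : Type*} [DecidableEq V] (G : SimpleGraph V) (S T : Finset V) : Prop :=
  ∃ v ∈ S, ∃ w, w ∉ S ∧ G.Adj v w ∧ (∀ u, G.Adj v u → u ∉ S → u = w) ∧ T = insert w S

/-- `S` is a zero forcing set: iterating the colour-change rule from `S` reaches all of `V`. -/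
def IsZeroForcingSet {V : Type*} [DecidableEq V] [Fintype V] (G : SimpleGraph V)
    (S : Finset V) : Prop :=
  Relation.ReflTransGen (zfStep G) S Finset.univ

/-- The zero forcing number: minimum size of a zero forcing set. -/
noncomputable def zeroForcingNumber {V : Type*} [DecidableEq V] [Fintype V]
    (G : SimpleGraph V) : ℕ :=
  sInf {k | ∃ S : Finset V, IsZeroForcingSet G S ∧ S.card = k}

/-- `(v 0, …, v (k-1))` is a Z-sequence: each `v i` has a neighbour outside
`⋃_{j<i} N[v j]`. -/
def IsZSeq {V : Type*} (G : SimpleGraph V) {k : ℕ} (v : Fin k → V) : Prop :=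
  ∀ i : Fin k, ∃ x, G.Adj (v i) x ∧ ∀ j : Fin k, j < i → x ≠ v j ∧ ¬ G.Adj (v j) x

/-- `w` is a witness sequence for the Z-sequence `v`: each `w i` is a neighbour of `v i`
lying outside `⋃_{j<i} N[v j]`. -/
def IsWitnessSeq {V : Type*} (G : SimpleGraph V) {k : ℕ} (v w : Fin k → V) : Prop :=
  ∀ i : Fin k, G.Adj (v i) (w i) ∧ ∀ j : Fin k, j < i → w i ≠ v j ∧ ¬ G.Adj (v j) (w i)

/-- The Z-Grundy domination number: maximum length of a Z-sequence. -/
noncomputable def zGrundyNumber {V : Type*} [Fintype V] (G : SimpleGraph V) : ℕ :=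
  sSup {k | ∃ v : Fin k → V, IsZSeq G v}
open scoped Classical in
/-- The proportion of simple `d`-regular graphs on the labelled vertex set `Fin n`
that satisfy the property `P`. -/
noncomputable def regularProportion (d n : ℕ) (P : SimpleGraph (Fin n) → Prop) : ℝ :=
  (Nat.card {G : SimpleGraph (Fin n) // G.IsRegularOfDegree d ∧ P G} : ℝ) /
    (Nat.card {G : SimpleGraph (Fin n) // G.IsRegularOfDegree d} : ℝ)

/-- The independence number of `G`: the maximum size of a set of pairwise non-adjacent
vertices. -/
noncomputable def indepNumber {V : Type*} (G : SimpleGraph V) : ℕ :=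
  sSup {k | ∃ s : Finset V, s.card = k ∧ ∀ a ∈ s, ∀ b ∈ s, ¬ G.Adj a b}

namespace ZFC

set_option linter.all false

section matchings

variable {P : Type*} [Fintype P] [DecidableEq P]

def IsM (σ : P → P) : Prop := ∀ x, σ (σ x) = x ∧ σ x ≠ x

open scoped Classical in
noncomputable def cell (F : Finset P) (τ : P → P) : Finset (P → P) :=
  Finset.univ.filter (fun σ => IsM σ ∧ ∀ x, x ∉ F → σ x = τ x)

def Mf : ℕ → ℕ
  | 0 => 1
  | 1 => 1
  | (k+2) => (k+1) * Mf k

lemma Mf_pos : ∀ k, 0 < Mf k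
  | 0 => by simp [Mf]
  | 1 => by simp [Mf]
  | (k+2) => by simp [Mf, Mf_pos k]

def upd (τ : P → P) (a b : P) : P → P := Function.update (Function.update τ a b) b a

lemma mem_cell {F : Finset P} {τ σ : P → P} :
    σ ∈ cell F τ ↔ IsM σ ∧ ∀ x, x ∉ F → σ x = τ x := by
  simp [cell]

def Cl (F : Finset P) (τ : P → P) : Prop := ∀ x, x ∉ F → τ x ∉ F

lemma Cl_upd {F : Finset P} {τ : P → P} (h : Cl F τ) (a b : P) :
    Cl ((F.erase a).erase b) (upd τ a b) := by
  intro x hx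
  unfold upd
  by_cases hb : x = b
  · subst hb; simp
  · by_cases ha : x = a
    · subst ha; simp [Function.update_of_ne hb]
    · have : x ∉ F := by
        intro hF; apply hx; simp [ha, hb, hF]
      rw [Function.update_of_ne hb, Function.update_of_ne ha]
      have := h x this
      simp [this]

lemma cell_fiber {F : Finset P} {τ : P → P} (h : Cl F τ) {a b : P} (ha : a ∈ F)
    (hb : b ∈ F.erase a) :
    (cell F τ).filter (fun σ => σ a = b) = cell ((F.erase a).erase b) (upd τ a b) := by
  have hba : b ≠ a := (Finset.mem_erase.1 hb).1
  have hbF : b ∈ F := (Finset.mem_erase.1 hb).2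
  ext σ
  simp only [Finset.mem_filter, mem_cell]
  constructor
  · rintro ⟨⟨hM, hσ⟩, hab⟩
    refine ⟨hM, ?_⟩
    intro x hx
    unfold upd
    by_cases hxb : x = b
    · subst hxb; simp; rw [← hab]; exact (hM a).1
    · by_cases hxa : x = a
      · subst hxa; simp [Function.update_of_ne hxb, hab]
      · rw [Function.update_of_ne hxb, Function.update_of_ne hxa]
        apply hσ
        intro hF; apply hx; simp [hxa, hxb, hF]
  · rintro ⟨hM, hσ⟩
    refine ⟨⟨hM, ?_⟩, ?_⟩
    · intro x hx
      have hxb : x ≠ b := by rintro rfl; exact hx hbF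
      have hxa : x ≠ a := by rintro rfl; exact hx ha
      rw [hσ x (by simp [hx])]
      unfold upd
      rw [Function.update_of_ne hxb, Function.update_of_ne hxa]
    · rw [hσ a (by simp)]
      unfold upd
      rw [Function.update_of_ne hba.symm]; simp

lemma expose {F : Finset P} {τ : P → P} (h : Cl F τ) {a : P} (ha : a ∈ F)
    {R : Type*} [AddCommMonoid R] (g : (P → P) → R) :
    ∑ σ ∈ cell F τ, g σ =
      ∑ b ∈ F.erase a, ∑ σ ∈ cell ((F.erase a).erase b) (upd τ a b), g σ := by
  rw [← Finset.sum_fiberwise_of_maps_to (s := cell F τ) (t := F.erase a) (g := fun σ => σ a)]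
  · apply Finset.sum_congr rfl
    intro b hb
    rw [← cell_fiber h ha hb]
  · intro σ hσ
    rw [mem_cell] at hσ
    obtain ⟨hM, hσ⟩ := hσ
    rw [Finset.mem_erase]
    refine ⟨(hM a).2, ?_⟩
    by_contra hn
    have h1 := h _ hn
    rw [← hσ _ hn, (hM a).1] at h1
    exact h1 ha

lemma card_cell_le (m : ℕ) : ∀ (F : Finset P) (τ : P → P), Cl F τ → F.card = m →
    (cell F τ).card ≤ Mf m := by
  induction m using Nat.strong_induction_on with
  | _ m ih =>
    intro F τ h hm
    rcases m with _ | _ | m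
    · rw [Finset.card_eq_zero] at hm
      subst hm
      simp only [Mf]
      rw [Finset.card_le_one]
      intro σ hσ σ' hσ'
      rw [mem_cell] at hσ hσ'
      funext x
      rw [hσ.2 x (by simp), hσ'.2 x (by simp)]
    · rw [Finset.card_eq_one] at hm
      obtain ⟨a, rfl⟩ := hm
      rw [Finset.card_eq_sum_ones, expose h (Finset.mem_singleton_self a)]
      simp
    · obtain ⟨a, ha⟩ : F.Nonempty := by rw [← Finset.card_pos]; omega
      rw [Finset.card_eq_sum_ones, expose h ha]
      have hc : (F.erase a).card = m + 1 := by rw [Finset.card_erase_of_mem ha]; omega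
      calc _ ≤ ∑ b ∈ F.erase a, Mf m := by
            apply Finset.sum_le_sum
            intro b hb
            rw [← Finset.card_eq_sum_ones]
            apply ih m (by omega) _ _ (Cl_upd h a b)
            rw [Finset.card_erase_of_mem hb]; omega
        _ = _ := by rw [Finset.sum_const, hc]; simp [Mf]

lemma card_cell_eq (m : ℕ) : ∀ (F : Finset P) (τ : P → P), Cl F τ → F.card = 2 * m →
    (∀ x, x ∉ F → τ (τ x) = x ∧ τ x ≠ x) →
    (cell F τ).card = Mf (2 * m) := by
  induction m with
  | zero =>
    intro F τ h hm hτ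
    rw [mul_zero, Finset.card_eq_zero] at hm
    subst hm
    rw [mul_zero]
    simp only [Mf]
    rw [Finset.card_eq_one]
    refine ⟨τ, ?_⟩
    ext σ
    rw [mem_cell, Finset.mem_singleton]
    constructor
    · rintro ⟨_, h2⟩; funext x; exact h2 x (by simp)
    · rintro rfl; exact ⟨fun x => hτ x (by simp), fun _ _ => rfl⟩
  | succ m ih =>
    intro F τ h hm hτ
    obtain ⟨a, ha⟩ : F.Nonempty := by rw [← Finset.card_pos]; omega
    rw [Finset.card_eq_sum_ones, expose h ha]
    have hc : (F.erase a).card = 2 * m + 1 := by rw [Finset.card_erase_of_mem ha]; omega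
    calc _ = ∑ b ∈ F.erase a, Mf (2 * m) := by
          apply Finset.sum_congr rfl
          intro b hb
          rw [← Finset.card_eq_sum_ones]
          have hba : b ≠ a := (Finset.mem_erase.1 hb).1
          have hbF : b ∈ F := (Finset.mem_erase.1 hb).2
          apply ih _ _ (Cl_upd h a b)
          · rw [Finset.card_erase_of_mem hb]; omega
          · intro x hx
            unfold upd
            by_cases hxb : x = b
            · subst hxb; simp [Function.update_of_ne hba.symm, hba.symm]
            · by_cases hxa : x = a
              · subst hxa; simp [Function.update_of_ne hxb, hba]
              · have hxF : x ∉ F := by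
                  intro hF; apply hx; simp [hxa, hxb, hF]
                rw [Function.update_of_ne hxb, Function.update_of_ne hxa]
                have h1 := h x hxF
                have h2 : τ x ≠ b := by intro h3; rw [h3] at h1; exact h1 hbF
                have h3 : τ x ≠ a := by intro h3; rw [h3] at h1; exact h1 ha
                rw [Function.update_of_ne h2, Function.update_of_ne h3]
                exact hτ x hxF
      _ = _ := by
          rw [Finset.sum_const, hc]
          show _ = Mf (2 * m + 2)
          simp [Mf]

end matchings

section zf

variable {V : Type*} [Fintype V] [DecidableEq V]

def Good (G : SimpleGraph V) (U : Finset V) (k : ℕ) : Prop :=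
  ∃ S T : Finset V, S.card + T.card ≤ k ∧ IsZeroForcingSet G (U ∪ S) ∧
    ∀ B : Finset V, B.Nonempty → Disjoint B (U ∪ T) → ∃ x ∈ B, ∃ y, y ∉ B ∧ G.Adj x y

lemma Good.mono {G : SimpleGraph V} {U : Finset V} {k l : ℕ} (h : Good G U k) (hkl : k ≤ l) :
    Good G U l := by
  obtain ⟨S, T, h1, h2⟩ := h
  exact ⟨S, T, h1.trans hkl, h2⟩

lemma good_base (G : SimpleGraph V) (U : Finset V) : Good G U (2 * Uᶜ.card) := by
  refine ⟨Uᶜ, Uᶜ, by omega, ?_, ?_⟩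
  · rw [Finset.union_compl]; exact Relation.ReflTransGen.refl
  · intro B hB hd
    rw [Finset.union_compl] at hd
    obtain ⟨b, hb⟩ := hB
    exact absurd (Finset.mem_univ b) (Finset.disjoint_left.1 hd hb)

lemma exit_aux {G : SimpleGraph V} {U T : Finset V} {v x : V} (hv : v ∈ U) (hvx : G.Adj v x)
    (h : ∀ B : Finset V, B.Nonempty → Disjoint B (insert x U ∪ T) →
      ∃ x ∈ B, ∃ y, y ∉ B ∧ G.Adj x y) :
    ∀ B : Finset V, B.Nonempty → Disjoint B (U ∪ T) → ∃ x ∈ B, ∃ y, y ∉ B ∧ G.Adj x y := by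
  intro B hB hd
  by_cases hx : x ∈ B
  · refine ⟨x, hx, v, ?_, hvx.symm⟩
    intro hvB
    rw [Finset.disjoint_left] at hd
    exact hd hvB (by simp [hv])
  · apply h B hB
    rw [Finset.insert_union, Finset.disjoint_insert_right]
    exact ⟨hx, hd⟩

lemma good_force {G : SimpleGraph V} {U : Finset V} {v x : V} {k : ℕ} (hv : v ∈ U)
    (hvx : G.Adj v x) (hN : ∀ y, G.Adj v y → y ∈ insert x U) (h : Good G (insert x U) k) :
    Good G U k := by
  obtain ⟨S, T, h1, h2, h3⟩ := h
  refine ⟨S, T, h1, ?_, exit_aux hv hvx h3⟩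
  rw [Finset.insert_union] at h2
  by_cases hx : x ∈ U ∪ S
  · rwa [Finset.insert_eq_of_mem hx] at h2
  · refine Relation.ReflTransGen.head ?_ h2
    refine ⟨v, by simp [hv], x, hx, hvx, ?_, rfl⟩
    intro u hu hu'
    have := hN u hu
    simp only [Finset.mem_insert, Finset.mem_union, not_or] at this hu'
    tauto

lemma good_buy {G : SimpleGraph V} {U : Finset V} {v x : V} {k : ℕ} (hv : v ∈ U)
    (hvx : G.Adj v x) (h : Good G (insert x U) k) :
    Good G U (k + 1) := by
  obtain ⟨S, T, h1, h2, h3⟩ := h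
  refine ⟨insert x S, T, ?_, ?_, exit_aux hv hvx h3⟩
  · have := Finset.card_insert_le x S; omega
  · rwa [Finset.union_insert, ← Finset.insert_union]

lemma good_start {G : SimpleGraph V} {U : Finset V} {x : V} {k : ℕ}
    (h : Good G (insert x U) k) :
    Good G U (k + 2) := by
  obtain ⟨S, T, h1, h2, h3⟩ := h
  refine ⟨insert x S, insert x T, ?_, ?_, ?_⟩
  · have := Finset.card_insert_le x S
    have := Finset.card_insert_le x T; omega
  · rwa [Finset.union_insert, ← Finset.insert_union]
  · rwa [Finset.union_insert, ← Finset.insert_union]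

noncomputable def cost (G : SimpleGraph V) (U : Finset V) : ℕ := sInf {k | Good G U k}

lemma cost_good (G : SimpleGraph V) (U : Finset V) : Good G U (cost G U) :=
  Nat.sInf_mem (s := {k | Good G U k}) ⟨_, good_base G U⟩

lemma cost_le {G : SimpleGraph V} {U : Finset V} {k : ℕ} (h : Good G U k) : cost G U ≤ k :=
  Nat.sInf_le h

lemma cost_base (G : SimpleGraph V) (U : Finset V) : cost G U ≤ 2 * Uᶜ.card :=
  cost_le (good_base G U)

lemma cost_force {G : SimpleGraph V} {U : Finset V} {v x : V} (hv : v ∈ U)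
    (hvx : G.Adj v x) (hN : ∀ y, G.Adj v y → y ∈ insert x U) :
    cost G U ≤ cost G (insert x U) :=
  cost_le (good_force hv hvx hN (cost_good _ _))

lemma cost_buy {G : SimpleGraph V} {U : Finset V} {v x : V} (hv : v ∈ U)
    (hvx : G.Adj v x) :
    cost G U ≤ cost G (insert x U) + 1 :=
  cost_le (good_buy hv hvx (cost_good _ _))

lemma cost_start (G : SimpleGraph V) (U : Finset V) (x : V) :
    cost G U ≤ cost G (insert x U) + 2 :=
  cost_le (good_start (cost_good _ _))

open scoped Classical in
lemma indep_greedy {G : SimpleGraph V} (hG : ∀ v, G.degree v ≤ 3) (m : ℕ) :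
    ∀ A : Finset V, A.card = m →
      (∀ B ⊆ A, B.Nonempty → ∃ x ∈ B, ∃ y, y ∉ B ∧ G.Adj x y) →
      ∃ I ⊆ A, (∀ a ∈ I, ∀ b ∈ I, ¬ G.Adj a b) ∧ A.card ≤ 3 * I.card := by
  induction m using Nat.strong_induction_on with
  | _ m ih =>
    intro A hm hA
    rcases A.eq_empty_or_nonempty with rfl | hne
    · exact ⟨∅, by simp⟩
    obtain ⟨x, hx, y, hy, hxy⟩ := hA A subset_rfl hne
    have hdeg : (A.filter (fun z => G.Adj x z)).card ≤ 2 := by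
      have h1 : A.filter (fun z => G.Adj x z) ⊆ (G.neighborFinset x).erase y := by
        intro z hz
        simp only [Finset.mem_filter] at hz
        simp only [Finset.mem_erase, SimpleGraph.mem_neighborFinset]
        exact ⟨by rintro rfl; exact hy hz.1, hz.2⟩
      have h2 := Finset.card_le_card h1
      rw [Finset.card_erase_of_mem (by simpa using hxy), SimpleGraph.card_neighborFinset_eq_degree] at h2
      have := hG x
      omega
    set A' := A.filter (fun z => z ≠ x ∧ ¬ G.Adj x z) with hA'
    have hsub : A' ⊆ A := Finset.filter_subset _ _
    have hcard : A.card ≤ A'.card + 3 := by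
      have : A ⊆ A' ∪ (insert x (A.filter (fun z => G.Adj x z))) := by
        intro z hz
        simp only [hA', Finset.mem_union, Finset.mem_filter, Finset.mem_insert]
        tauto
      have h2 := Finset.card_le_card this
      have h3 := Finset.card_union_le A' (insert x (A.filter (fun z => G.Adj x z)))
      have h4 := Finset.card_insert_le x (A.filter (fun z => G.Adj x z))
      omega
    have hlt : A'.card < m := by
      rw [← hm]
      apply Finset.card_lt_card
      rw [Finset.ssubset_iff_of_subset hsub]
      exact ⟨x, hx, by simp [hA']⟩
    obtain ⟨I, hI, hind, hIc⟩ := ih _ hlt A' rfl (fun B hB => hA B (hB.trans hsub))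
    have hxI : x ∉ I := fun h => by have := hI h; simp [hA'] at this
    refine ⟨insert x I, ?_, ?_, ?_⟩
    · intro z hz
      rcases Finset.mem_insert.1 hz with rfl | hz
      · exact hx
      · exact hsub (hI hz)
    · have key : ∀ z ∈ I, ¬ G.Adj x z := by
        intro z hz
        have := hI hz
        simp only [hA', Finset.mem_filter] at this
        exact this.2.2
      intro a ha b hb
      rcases Finset.mem_insert.1 ha with ha' | ha' <;> rcases Finset.mem_insert.1 hb with hb' | hb'
      · rw [ha', hb']; exact G.loopless.irrefl _
      · rw [ha']; exact key b hb'
      · rw [hb']; exact fun h => key a ha' h.symm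
      · exact hind a ha' b hb'
    · rw [Finset.card_insert_of_notMem hxI]; omega

open scoped Classical in
lemma final_of_cost {G : SimpleGraph V} (hG : ∀ v, G.degree v ≤ 3)
    (h : 3 * cost G ∅ ≤ Fintype.card V) :
    zeroForcingNumber G ≤ indepNumber G + 1 := by
  obtain ⟨S, T, h1, h2, h3⟩ := cost_good G ∅
  have hZ : zeroForcingNumber G ≤ S.card := by
    apply Nat.sInf_le
    exact ⟨S, by simpa using h2, rfl⟩
  obtain ⟨I, -, hI, hc⟩ := indep_greedy hG _ (Tᶜ) rfl (by
    intro B hB hne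
    apply h3 B hne
    rw [Finset.empty_union]
    rw [Finset.disjoint_left]
    intro a ha
    simpa using hB ha)
  have hα : I.card ≤ indepNumber G := by
    apply le_csSup
    · refine ⟨Fintype.card V, ?_⟩
      rintro k ⟨s, rfl, -⟩
      exact Finset.card_le_univ s
    · exact ⟨I, rfl, hI⟩
  rw [Finset.card_compl] at hc
  omega

end zf

section state

variable {V : Type*} [Fintype V] [DecidableEq V]

def fr (F : Finset (V × Fin 3)) (v : V) : ℕ := (Finset.univ.filter (fun i => (v, i) ∈ F)).card

def nj (j : ℕ) (F : Finset (V × Fin 3)) : ℕ := (Finset.univ.filter (fun v => fr F v = j)).card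

def Ub (F : Finset (V × Fin 3)) : Finset V := Finset.univ.filter (fun v => fr F v ≠ 3)

lemma fr_le (F : Finset (V × Fin 3)) (v : V) : fr F v ≤ 3 := by
  unfold fr
  exact (Finset.card_le_univ _).trans (by simp)

lemma fr_pos {F : Finset (V × Fin 3)} {a : V × Fin 3} (ha : a ∈ F) : 0 < fr F a.1 := by
  unfold fr
  rw [Finset.card_pos]
  exact ⟨a.2, by simpa using ha⟩

lemma fr_erase {F : Finset (V × Fin 3)} {a : V × Fin 3} (ha : a ∈ F) (v : V) :
    fr (F.erase a) v = if v = a.1 then fr F v - 1 else fr F v := by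
  split_ifs with h
  · subst h
    unfold fr
    rw [← Finset.card_erase_of_mem (a := a.2) (by simpa using ha)]
    congr 1
    ext i
    simp only [Finset.mem_filter, Finset.mem_erase, Finset.mem_univ, true_and]
    rw [Ne, Prod.ext_iff]
    simp
  · unfold fr
    congr 1
    ext i
    simp only [Finset.mem_filter, Finset.mem_erase, Finset.mem_univ, true_and]
    rw [Ne, Prod.ext_iff]
    simp [h]

lemma nj_erase {F : Finset (V × Fin 3)} {a : V × Fin 3} (ha : a ∈ F) (j : ℕ) :
    nj j (F.erase a) + (if fr F a.1 = j then 1 else 0)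
      = nj j F + (if fr F a.1 = j + 1 then 1 else 0) := by
  have hp := fr_pos ha
  have e : ∀ F' : Finset (V × Fin 3), nj j F' =
      (if fr F' a.1 = j then 1 else 0) + ∑ v ∈ Finset.univ.erase a.1, (if fr F' v = j then 1 else 0) := by
    intro F'
    unfold nj
    rw [Finset.card_filter, ← Finset.add_sum_erase _ _ (Finset.mem_univ a.1)]
  rw [e (F.erase a), e F]
  have : ∑ v ∈ Finset.univ.erase a.1, (if fr (F.erase a) v = j then 1 else 0)
      = ∑ v ∈ Finset.univ.erase a.1, (if fr F v = j then 1 else 0) := by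
    apply Finset.sum_congr rfl
    intro v hv
    rw [fr_erase ha, if_neg (Finset.mem_erase.1 hv).1]
  rw [this, fr_erase ha, if_pos rfl]
  split_ifs <;> omega

lemma sum_fr (F : Finset (V × Fin 3)) (φ : ℕ → ℝ) :
    ∑ b ∈ F, φ (fr F b.1) = 3 * nj 3 F * φ 3 + 2 * nj 2 F * φ 2 + nj 1 F * φ 1 := by
  have h1 : ∑ b ∈ F, φ (fr F b.1) = ∑ v : V, (fr F v : ℝ) * φ (fr F v) := by
    have : F = Finset.univ.filter (fun b => b ∈ F) := by simp
    conv_lhs => rw [this, Finset.sum_filter, Fintype.sum_prod_type]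
    apply Finset.sum_congr rfl
    intro v _
    rw [← Finset.sum_filter]
    rw [← this]
    simp [fr]
  rw [h1]
  have h2 : ∀ v : V, (fr F v : ℝ) * φ (fr F v) =
      (if fr F v = 3 then 3 * φ 3 else 0) + (if fr F v = 2 then 2 * φ 2 else 0)
       + (if fr F v = 1 then φ 1 else 0) := by
    intro v
    have := fr_le F v
    interval_cases fr F v <;> simp
  simp_rw [h2, Finset.sum_add_distrib, ← Finset.sum_filter, Finset.sum_const, nsmul_eq_mul]
  unfold nj
  ring

lemma card_eq_nj (F : Finset (V × Fin 3)) : F.card = 3 * nj 3 F + 2 * nj 2 F + nj 1 F := by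
  have := sum_fr F (fun _ => 1)
  simp at this
  exact_mod_cast this

lemma mem_Ub_of_notMem {F : Finset (V × Fin 3)} {x : V × Fin 3} (hx : x ∉ F) : x.1 ∈ Ub F := by
  simp only [Ub, Finset.mem_filter, Finset.mem_univ, true_and]
  intro h
  unfold fr at h
  have : Finset.univ.filter (fun i => (x.1, i) ∈ F) = Finset.univ := by
    rw [← Finset.card_eq_iff_eq_univ]; simpa using h
  have h2 : x.2 ∈ Finset.univ.filter (fun i => (x.1, i) ∈ F) := by rw [this]; simp
  simp at h2
  exact hx h2

lemma Ub_erase {F : Finset (V × Fin 3)} {a : V × Fin 3} (ha : a ∈ F) :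
    Ub (F.erase a) = insert a.1 (Ub F) := by
  ext v
  simp only [Ub, Finset.mem_filter, Finset.mem_univ, true_and, Finset.mem_insert, fr_erase ha]
  have := fr_le F v
  split_ifs with h
  · subst h; simp; omega
  · simp [h]

lemma card_Ub_compl (F : Finset (V × Fin 3)) : (Ub F)ᶜ.card = nj 3 F := by
  unfold nj Ub
  congr 1
  ext v
  simp

lemma mem_Ub {F : Finset (V × Fin 3)} {v : V} : v ∈ Ub F ↔ fr F v ≠ 3 := by simp [Ub]

def gr (σ : V × Fin 3 → V × Fin 3) : SimpleGraph V :=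
  SimpleGraph.fromRel (fun u v => ∃ i, (σ (u, i)).1 = v)

lemma gr_adj {σ : V × Fin 3 → V × Fin 3} (h : IsM σ) (u v : V) :
    (gr σ).Adj u v ↔ u ≠ v ∧ ∃ i, (σ (u, i)).1 = v := by
  unfold gr
  rw [SimpleGraph.fromRel_adj]
  constructor
  · rintro ⟨h1, h2 | ⟨i, h2⟩⟩
    · exact ⟨h1, h2⟩
    · refine ⟨h1, (σ (v, i)).2, ?_⟩
      rw [← h2]
      show (σ (σ (v, i))).1 = v
      rw [(h _).1]
  · rintro ⟨h1, h2⟩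
    exact ⟨h1, Or.inl h2⟩

variable {F : Finset (V × Fin 3)} {σ : V × Fin 3 → V × Fin 3}

lemma eq_of_fr_one {a c : V × Fin 3} (ha : a ∈ F) (h1 : fr F a.1 = 1) (hc : c ∈ F)
    (hac : c.1 = a.1) : c = a := by
  unfold fr at h1
  rw [Finset.card_eq_one] at h1
  obtain ⟨j, hj⟩ := h1
  have e1 : a.2 ∈ ({j} : Finset (Fin 3)) := by rw [← hj]; simpa using ha
  have e2 : c.2 ∈ ({j} : Finset (Fin 3)) := by rw [← hj]; simp [← hac, hc]
  simp at e1 e2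
  ext1
  · exact hac
  · rw [e1, e2]

lemma adj_of {a : V × Fin 3} (hM : IsM σ) (h : a.1 ≠ (σ a).1) : (gr σ).Adj a.1 (σ a).1 := by
  rw [gr_adj hM]
  exact ⟨h, a.2, rfl⟩

lemma cost_same {a b : V × Fin 3} (G : SimpleGraph V) (ha : a ∈ F) (hb : b ∈ F) (hab : b ≠ a)
    (ha' : a.1 ∈ Ub F) (hb' : b.1 ∈ Ub F) :
    cost G (Ub F) = cost G (Ub ((F.erase a).erase b)) := by
  rw [Ub_erase (by simp [hab, hb]), Ub_erase ha, Finset.insert_eq_of_mem ha',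
    Finset.insert_eq_of_mem hb']

lemma cost_one {a : V × Fin 3} (hM : IsM σ) (hC : ∀ x, x ∉ F → σ x ∉ F) (ha : a ∈ F)
    (h1 : fr F a.1 = 1) (hb : σ a ∈ F) :
    cost (gr σ) (Ub F) ≤ cost (gr σ) (Ub ((F.erase a).erase (σ a))) := by
  have hab : σ a ≠ a := (hM a).2
  have haU : a.1 ∈ Ub F := by rw [mem_Ub]; omega
  by_cases hb' : (σ a).1 ∈ Ub F
  · exact (cost_same _ ha hb hab haU hb').le
  · rw [Ub_erase (by simp [hab, hb]), Ub_erase ha, Finset.insert_eq_of_mem haU]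
    have hne : a.1 ≠ (σ a).1 := by intro h; rw [← h] at hb'; exact hb' haU
    apply cost_force haU (adj_of hM hne)
    intro y hy
    rw [gr_adj hM] at hy
    obtain ⟨_, i, rfl⟩ := hy
    by_cases hi : (a.1, i) ∈ F
    · have := eq_of_fr_one ha h1 hi rfl
      rw [this]; simp
    · rw [Finset.mem_insert]; right
      exact mem_Ub_of_notMem (hC _ hi)

lemma eq_of_fr_two {a a' c : V × Fin 3} (ha : a ∈ F) (ha' : a' ∈ F) (hne : a' ≠ a)
    (haa : a'.1 = a.1) (h1 : fr F a.1 = 2) (hc : c ∈ F)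
    (hac : c.1 = a.1) : c = a ∨ c = a' := by
  by_cases h : c = a
  · exact Or.inl h
  · right
    apply eq_of_fr_one (F := F.erase a) (by simp [hne, ha']) _ (by simp [h, hc]) (by rw [hac, haa])
    rw [fr_erase ha, if_pos haa, haa, h1]

lemma cost_two {a a' : V × Fin 3} (hM : IsM σ) (hC : ∀ x, x ∉ F → σ x ∉ F) (ha : a ∈ F)
    (ha' : a' ∈ F) (hne : a' ≠ a) (haa : a'.1 = a.1)
    (h1 : fr F a.1 = 2) (hb : σ a ∈ F) (hb' : σ a' ∈ F) (hbU : (σ a).1 ∉ Ub F) :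
    cost (gr σ) (Ub F) ≤
      cost (gr σ) (insert (σ a').1 (insert (σ a).1 (Ub F))) +
        (if (σ a').1 ∈ insert (σ a).1 (Ub F) then 0 else 1) := by
  have haU : a.1 ∈ Ub F := by rw [mem_Ub]; omega
  have hne1 : a.1 ≠ (σ a).1 := by intro h; rw [← h] at hbU; exact hbU haU
  have hN : ∀ y, (gr σ).Adj a.1 y → y ∈ insert (σ a).1 (insert (σ a').1 (Ub F)) := by
    intro y hy
    rw [gr_adj hM] at hy
    obtain ⟨_, i, rfl⟩ := hy
    by_cases hi : (a.1, i) ∈ F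
    · rcases eq_of_fr_two ha ha' hne haa h1 hi rfl with h | h <;> rw [h] <;> simp
    · have := mem_Ub_of_notMem (hC _ hi)
      simp [this]
  split_ifs with h
  · rw [Finset.insert_eq_of_mem h, add_zero]
    apply cost_force haU (adj_of hM hne1)
    intro y hy
    have := hN y hy
    simp only [Finset.mem_insert] at this h ⊢
    rcases this with h2 | h2 | h2
    · tauto
    · rw [h2]; exact h
    · tauto
  · have hne2 : a'.1 ≠ (σ a').1 := by
      intro h'; apply h; rw [← h', haa]; simp [haU]
    have hadj := adj_of hM hne2
    rw [haa] at hadj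
    refine (cost_buy haU hadj).trans ?_
    rw [Finset.insert_comm]
    gcongr
    exact cost_force (by simp [haU]) (adj_of hM hne1) hN

lemma cost_restart {a b : V × Fin 3} (hM : IsM σ) (ha : a ∈ F) (hb : b ∈ F) (hab : σ a = b)
     :
    cost (gr σ) (Ub F) ≤ cost (gr σ) (Ub ((F.erase a).erase b)) + 3 := by
  have hne : b ≠ a := by rw [← hab]; exact (hM a).2
  rw [Ub_erase (by simp [hne, hb]), Ub_erase ha]
  have h1 := cost_start (gr σ) (Ub F) a.1
  by_cases h : b.1 = a.1
  · rw [h, Finset.insert_eq_of_mem (Finset.mem_insert_self _ _)]; omega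
  · have h2 : (gr σ).Adj a.1 b.1 := by
      rw [← hab]; apply adj_of hM; rw [hab]; exact fun h' => h h'.symm
    have h3 := cost_buy (U := insert a.1 (Ub F)) (by simp) h2
    omega

lemma one_play {τ : V × Fin 3 → V × Fin 3} (hC : Cl F τ) {a : V × Fin 3} (ha : a ∈ F)
    (h1 : fr F a.1 = 1) (g : (V × Fin 3 → V × Fin 3) → ℝ) (E : ℕ → ℝ) (K : ℝ)
    (h : ∀ b ∈ F.erase a, ∑ σ ∈ cell ((F.erase a).erase b) (upd τ a b), g σ ≤ K * E (fr F b.1)) :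
    ∑ σ ∈ cell F τ, g σ ≤ K * (3 * nj 3 F * E 3 + 2 * nj 2 F * E 2 + ((nj 1 F : ℝ) - 1) * E 1) := by
  rw [expose hC ha]
  refine (Finset.sum_le_sum h).trans ?_
  rw [← Finset.mul_sum]
  have := sum_fr F E
  rw [← Finset.add_sum_erase _ _ ha, h1] at this
  apply le_of_eq
  congr 1
  linarith

end state

section main

variable {V : Type*} [Fintype V] [DecidableEq V]

structure Pot (lam : ℝ) (w0 : ℕ) (N : ℕ) (Ψ : ℕ → ℕ → ℕ → ℝ) : Prop where
  pos : ∀ w R q, 0 ≤ Ψ w R q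
  base : ∀ w R q, w ≤ w0 → Real.exp (lam * (2 * w)) ≤ Ψ w R q
  one : ∀ w p q R, w0 < w → w ≤ N → 1 ≤ q → R = 3 * w + 2 * p + q →
    3 * (w : ℝ) * Ψ (w - 1) (R - 2) (q - 1) + 2 * (p : ℝ) * Ψ w (R - 2) q
      + ((q : ℝ) - 1) * Ψ w (R - 2) (q - 2) ≤ ((R : ℝ) - 1) * Ψ w R q
  two : ∀ w p R, w0 < w → w ≤ N → 1 ≤ p → R = 3 * w + 2 * p →
    Ψ w (R - 2) 0 + (2 * (p : ℝ) - 2) * Ψ w (R - 2) 2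
      + 3 * (w : ℝ) * (1 / ((R : ℝ) - 3) * (3 * ((w : ℝ) - 1) * (Real.exp lam * Ψ (w - 2) (R - 4) 0)
        + 2 * (p : ℝ) * Ψ (w - 1) (R - 4) 1)) ≤ ((R : ℝ) - 1) * Ψ w R 0
  three : ∀ w R, w0 < w → w ≤ N → R = 3 * w →
    2 * (Real.exp (3 * lam) * Ψ (w - 1) (R - 2) 1)
      + 3 * ((w : ℝ) - 1) * (Real.exp (3 * lam) * Ψ (w - 2) (R - 2) 0) ≤ ((R : ℝ) - 1) * Ψ w R 0

lemma card_erase2 {F : Finset (V × Fin 3)} {a b : V × Fin 3} (ha : a ∈ F) (hb : b ∈ F.erase a) :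
    ((F.erase a).erase b).card = F.card - 2 := by
  rw [Finset.card_erase_of_mem hb, Finset.card_erase_of_mem ha]; omega

lemma Mf_two {R : ℕ} (h : 2 ≤ R) : (Mf R : ℝ) = Mf (R - 2) * ((R : ℝ) - 1) := by
  obtain ⟨k, rfl⟩ := Nat.exists_eq_add_of_le' h
  simp [Mf]; ring

lemma cell_closed {P : Type*} [Fintype P] [DecidableEq P] {F : Finset P} {τ σ : P → P}
    (h : Cl F τ) (hσ : σ ∈ cell F τ) : ∀ x, x ∉ F → σ x ∉ F := by
  intro x hx
  rw [(mem_cell.1 hσ).2 x hx]; exact h x hx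

lemma cell_sub {P : Type*} [Fintype P] [DecidableEq P] {F : Finset P} {τ σ : P → P}
    (h : Cl F τ) {a b : P} (ha : a ∈ F) (hb : b ∈ F.erase a)
    (hσ : σ ∈ cell ((F.erase a).erase b) (upd τ a b)) : σ ∈ cell F τ ∧ σ a = b := by
  rw [← cell_fiber h ha hb] at hσ
  simpa using hσ

lemma exists_fr {F : Finset (V × Fin 3)} {j : ℕ} (hj : 1 ≤ j) (h : 1 ≤ nj j F) :
    ∃ a ∈ F, fr F a.1 = j := by
  obtain ⟨v, hv⟩ := Finset.card_pos.1 h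
  simp at hv
  have : 0 < fr F v := by omega
  obtain ⟨i, hi⟩ := Finset.card_pos.1 this
  simp at hi
  exact ⟨(v, i), hi, hv⟩

theorem main_bound {lam : ℝ} (hl : 0 ≤ lam) {w0 : ℕ} {Ψ : ℕ → ℕ → ℕ → ℝ} (hw0 : 2 ≤ w0)
    (hP : Pot lam w0 (Fintype.card V) Ψ) (m : ℕ) :
    ∀ (F : Finset (V × Fin 3)) (τ : V × Fin 3 → V × Fin 3), F.card = m → Cl F τ →
      ∑ σ ∈ cell F τ, Real.exp (lam * cost (gr σ) (Ub F)) ≤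
        Mf F.card * Ψ (nj 3 F) F.card (nj 1 F) := by
  induction m using Nat.strong_induction_on with
  | _ m ih =>
  intro F τ hm hC
  have hR := card_eq_nj F
  have hn3 : nj 3 F ≤ Fintype.card V := by unfold nj; exact Finset.card_le_univ _
  have hMpos : (0:ℝ) < Mf F.card := by exact_mod_cast Mf_pos _
  have hMpos2 : (0:ℝ) < Mf (F.card - 2) := by exact_mod_cast Mf_pos _
  by_cases hw : nj 3 F ≤ w0
  · calc ∑ σ ∈ cell F τ, Real.exp (lam * cost (gr σ) (Ub F))
        ≤ ∑ σ ∈ cell F τ, Ψ (nj 3 F) F.card (nj 1 F) := by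
          apply Finset.sum_le_sum
          intro σ _
          refine le_trans ?_ (hP.base _ _ _ hw)
          apply Real.exp_le_exp.2
          apply mul_le_mul_of_nonneg_left _ hl
          have := cost_base (gr σ) (Ub F)
          rw [card_Ub_compl] at this
          exact_mod_cast this
      _ = (cell F τ).card * Ψ (nj 3 F) F.card (nj 1 F) := by simp
      _ ≤ _ := by
          gcongr
          · exact hP.pos _ _ _
          · exact card_cell_le _ F τ hC rfl
  push Not at hw
  have hcard : 9 ≤ F.card := by omega
  have IH : ∀ a b, a ∈ F → b ∈ F.erase a → 
      ∑ σ ∈ cell ((F.erase a).erase b) (upd τ a b), 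
        Real.exp (lam * cost (gr σ) (Ub ((F.erase a).erase b))) ≤
        Mf (F.card - 2) * Ψ (nj 3 ((F.erase a).erase b)) (F.card - 2) (nj 1 ((F.erase a).erase b)) := by
    intro a b ha hb
    have := ih (F.card - 2) (by omega) ((F.erase a).erase b) (upd τ a b) (card_erase2 ha hb)
      (Cl_upd hC a b)
    rwa [card_erase2 ha hb] at this
  by_cases hq : 1 ≤ nj 1 F
  · -- one play
    obtain ⟨a, ha, h1⟩ := exists_fr le_rfl hq
    refine (one_play hC ha h1 _ (fun j => if j = 3 then Ψ (nj 3 F - 1) (F.card - 2) (nj 1 F - 1)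
      else if j = 2 then Ψ (nj 3 F) (F.card - 2) (nj 1 F)
      else Ψ (nj 3 F) (F.card - 2) (nj 1 F - 2)) (Mf (F.card - 2)) ?_).trans ?_
    · intro b hb
      have hbF := Finset.mem_of_mem_erase hb
      have hba := Finset.ne_of_mem_erase hb
      have hne : b.1 ≠ a.1 := fun h => hba (eq_of_fr_one ha h1 hbF h)
      have step : ∑ σ ∈ cell ((F.erase a).erase b) (upd τ a b), 
        Real.exp (lam * cost (gr σ) (Ub F)) ≤ ∑ σ ∈ cell ((F.erase a).erase b) (upd τ a b), 
        Real.exp (lam * cost (gr σ) (Ub ((F.erase a).erase b))) := by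
        apply Finset.sum_le_sum
        intro σ hσ
        obtain ⟨hσ', hab⟩ := cell_sub hC ha hb hσ
        apply Real.exp_le_exp.2
        apply mul_le_mul_of_nonneg_left _ hl
        have := cost_one (mem_cell.1 hσ').1 (cell_closed hC hσ') ha h1 (by rw [hab]; exact hbF)
        rw [hab] at this
        exact_mod_cast this
      refine (step.trans (IH a b ha hb)).trans (le_of_eq ?_)
      have f1 : fr (F.erase a) b.1 = fr F b.1 := by rw [fr_erase ha, if_neg hne]
      have e1 := nj_erase ha 1
      have e3 := nj_erase ha 3
      have g1 := nj_erase hb 1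
      have g3 := nj_erase hb 3
      rw [f1] at g1 g3
      rw [h1] at e1 e3
      have hle := fr_le F b.1
      have hpos := fr_pos hbF
      simp only [] at *
      congr 1
      interval_cases hfr : fr F b.1 <;> simp at * <;> congr 1 <;> omega
    · rw [Mf_two (R := F.card) (by omega)]
      have := hP.one _ _ _ _ hw hn3 hq hR
      rw [mul_assoc (Mf (F.card - 2) : ℝ)]
      apply mul_le_mul_of_nonneg_left _ hMpos2.le
      simpa using this
  have hq0 : nj 1 F = 0 := by omega
  by_cases hp : 1 ≤ nj 2 F
  · -- two play
    obtain ⟨a, ha, h1⟩ := exists_fr (by norm_num) hp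
    obtain ⟨a', ha', haa⟩ : ∃ a' ∈ F.erase a, a'.1 = a.1 := by
      have : 0 < fr (F.erase a) a.1 := by rw [fr_erase ha, if_pos rfl, h1]; norm_num
      obtain ⟨i, hi⟩ := Finset.card_pos.1 this
      exact ⟨(a.1, i), by simpa using hi, rfl⟩
    have haF' := Finset.mem_of_mem_erase ha'
    have hne := Finset.ne_of_mem_erase ha'
    have haU : a.1 ∈ Ub F := by rw [mem_Ub]; omega
    rw [expose hC ha, ← Finset.add_sum_erase _ _ ha']
    -- bound for black partner
    have blk : ∀ b ∈ F.erase a, b.1 ∈ Ub F → 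
        ∑ σ ∈ cell ((F.erase a).erase b) (upd τ a b), Real.exp (lam * cost (gr σ) (Ub F)) ≤
        Mf (F.card - 2) * Ψ (nj 3 ((F.erase a).erase b)) (F.card - 2) (nj 1 ((F.erase a).erase b)) := by
      intro b hb hbU
      refine le_trans (le_of_eq ?_) (IH a b ha hb)
      apply Finset.sum_congr rfl
      intro σ _
      rw [cost_same (gr σ) ha (Finset.mem_of_mem_erase hb) (Finset.ne_of_mem_erase hb) haU hbU]
    have B1 : ∑ σ ∈ cell ((F.erase a).erase a') (upd τ a a'), Real.exp (lam * cost (gr σ) (Ub F)) ≤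
        Mf (F.card - 2) * Ψ (nj 3 F) (F.card - 2) 0 := by
      refine (blk a' ha' (by rw [haa]; exact haU)).trans (le_of_eq ?_)
      have f1 : fr (F.erase a) a'.1 = 1 := by rw [fr_erase ha, if_pos haa, haa, h1]
      have e1 := nj_erase ha 1
      have e3 := nj_erase ha 3
      have g1 := nj_erase ha' 1
      have g3 := nj_erase ha' 3
      rw [f1] at g1 g3
      rw [h1] at e1 e3
      simp at e1 e3 g1 g3
      have q1 : nj 3 ((F.erase a).erase a') = nj 3 F := by omega
      have q2 : nj 1 ((F.erase a).erase a') = 0 := by omega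
      rw [q1, q2]
    set Q := 1 / ((F.card : ℝ) - 3) * (3 * ((nj 3 F : ℝ) - 1) * (Real.exp lam * Ψ (nj 3 F - 2) (F.card - 4) 0)
        + 2 * (nj 2 F : ℝ) * Ψ (nj 3 F - 1) (F.card - 4) 1) with hQ
    set E : ℕ → ℝ := fun j => if j = 3 then Q else Ψ (nj 3 F) (F.card - 2) 2 with hE
    have B2 : ∀ b ∈ (F.erase a).erase a', 
        ∑ σ ∈ cell ((F.erase a).erase b) (upd τ a b), Real.exp (lam * cost (gr σ) (Ub F)) ≤
        Mf (F.card - 2) * E (fr F b.1) := by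
      intro b hb
      have hb1 := Finset.mem_of_mem_erase hb
      have hba' := Finset.ne_of_mem_erase hb
      have hbF := Finset.mem_of_mem_erase hb1
      have hba := Finset.ne_of_mem_erase hb1
      have hneq : b.1 ≠ a.1 := by
        intro h
        rcases eq_of_fr_two ha haF' hne haa h1 hbF h with h | h
        · exact hba h
        · exact hba' h
      have f1 : fr (F.erase a) b.1 = fr F b.1 := by rw [fr_erase ha, if_neg hneq]
      have e1 := nj_erase ha 1
      have e2 := nj_erase ha 2
      have e3 := nj_erase ha 3
      have g1 := nj_erase hb1 1
      have g2 := nj_erase hb1 2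
      have g3 := nj_erase hb1 3
      rw [f1] at g1 g2 g3
      rw [h1] at e1 e2 e3
      by_cases h3 : fr F b.1 = 3
      · rw [h3] at g1 g2 g3 ⊢
        simp only [hE, if_true]
        set F2 := (F.erase a).erase b with hF2
        have haF2 : a' ∈ F2 := by
          rw [hF2, Finset.mem_erase]; exact ⟨fun h => hba' h.symm, ha'⟩
        have frv : ∀ v, fr F2 v = if v = b.1 then 2 else if v = a.1 then 1 else fr F v := by
          intro v
          rw [hF2, fr_erase hb1, fr_erase ha]
          split_ifs with h h' h' 
          · rw [h] at h'; exact absurd h' hneq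
          · rw [h, h3]
          · rw [h', h1]
          · rfl
        have fa' : fr F2 a'.1 = 1 := by rw [frv, haa, if_neg hneq.symm, if_pos rfl]
        have hc2 : F2.card = F.card - 2 := card_erase2 ha hb1
        have hC2 := Cl_upd hC a b
        rw [← hF2] at hC2
        have bU : b.1 ∉ Ub F := by rw [mem_Ub]; simp [h3]
        have UF2 : Ub F2 = insert b.1 (Ub F) := by
          rw [hF2, Ub_erase hb1, Ub_erase ha, Finset.insert_eq_of_mem haU]
        refine (one_play hC2 haF2 fa' _ (fun j => if j = 3 then 
            Real.exp lam * Ψ (nj 3 F - 2) (F.card - 4) 0 else Ψ (nj 3 F - 1) (F.card - 4) 1)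
            (Mf (F.card - 4)) ?_).trans ?_
        · intro b' hb'
          have hb'F2 := Finset.mem_of_mem_erase hb'
          have hb'a := Finset.ne_of_mem_erase hb'
          have hb'F : b' ∈ F := by
            rw [hF2] at hb'F2; exact Finset.mem_of_mem_erase (Finset.mem_of_mem_erase hb'F2)
          have hne' : b'.1 ≠ a'.1 := fun h => hb'a (eq_of_fr_one haF2 fa' hb'F2 h)
          have UF4 : Ub ((F2.erase a').erase b') = insert b'.1 (insert b.1 (Ub F)) := by
            rw [Ub_erase hb', Ub_erase haF2, UF2, Finset.insert_eq_of_mem (a := a'.1)]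
            rw [haa]; simp [haU]
          have hc4 : ((F2.erase a').erase b').card = F.card - 4 := by
            rw [card_erase2 haF2 hb', hc2]; omega
          have IH4 := ih (F.card - 4) (by omega) ((F2.erase a').erase b') (upd (upd τ a b) a' b') 
            hc4 (Cl_upd hC2 a' b')
          rw [hc4] at IH4
          have step : ∑ σ ∈ cell ((F2.erase a').erase b') (upd (upd τ a b) a' b'), 
              Real.exp (lam * cost (gr σ) (Ub F)) ≤ 
              (if fr F2 b'.1 = 3 then Real.exp lam else 1) * 
              ∑ σ ∈ cell ((F2.erase a').erase b') (upd (upd τ a b) a' b'), 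
              Real.exp (lam * cost (gr σ) (Ub ((F2.erase a').erase b'))) := by
            rw [Finset.mul_sum]
            apply Finset.sum_le_sum
            intro σ hσ
            obtain ⟨hσ2, hab'⟩ := cell_sub hC2 haF2 hb' hσ
            obtain ⟨hσ', hab⟩ := cell_sub hC ha hb1 hσ2
            have key := cost_two (mem_cell.1 hσ').1 (cell_closed hC hσ') ha haF' hne haa h1
              (by rw [hab]; exact hbF) (by rw [hab']; exact hb'F) (by rw [hab]; exact bU)
            rw [hab, hab', ← UF4, ← UF2] at key
            by_cases h4 : fr F2 b'.1 = 3
            · rw [if_neg (by rw [mem_Ub]; simpa using h4)] at key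
              rw [if_pos h4, ← Real.exp_add]
              apply Real.exp_le_exp.2
              have : (cost (gr σ) (Ub F) : ℝ) ≤ cost (gr σ) (Ub ((F2.erase a').erase b')) + 1 := by
                exact_mod_cast key
              nlinarith
            · rw [if_pos (by rw [mem_Ub]; simpa using h4)] at key
              rw [if_neg h4, one_mul]
              apply Real.exp_le_exp.2
              apply mul_le_mul_of_nonneg_left _ hl
              exact_mod_cast key
          have k1 := nj_erase haF2 1
          have k3 := nj_erase haF2 3
          have m1 := nj_erase hb' 1
          have m3 := nj_erase hb' 3
          have f2 : fr (F2.erase a') b'.1 = fr F2 b'.1 := by rw [fr_erase haF2, if_neg hne']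
          rw [f2] at m1 m3
          rw [fa'] at k1 k3
          have hle := fr_le F2 b'.1
          have hpos := fr_pos hb'F2
          have hn1 : fr F2 b'.1 ≠ 1 := by
            intro h
            rw [frv] at h
            by_cases h5 : b'.1 = b.1
            · rw [if_pos h5] at h; omega
            · rw [if_neg h5, if_neg (fun h6 => hne' (h6.trans haa.symm))] at h
              have : 1 ≤ nj 1 F := Finset.card_pos.2 ⟨b'.1, by simpa using h⟩
              omega
          refine (step.trans (mul_le_mul_of_nonneg_left IH4 (by split_ifs <;> positivity))).trans ?_
          apply le_of_eq
          interval_cases hfr : fr F2 b'.1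
          · exact absurd rfl hn1
          · simp at k1 k3 m1 m3 e1 e2 e3 g1 g2 g3
            have q1 : nj 3 ((F2.erase a').erase b') = nj 3 F - 1 := by omega
            have q2 : nj 1 ((F2.erase a').erase b') = 1 := by omega
            rw [q1, q2]; simp
          · simp at k1 k3 m1 m3 e1 e2 e3 g1 g2 g3
            have q1 : nj 3 ((F2.erase a').erase b') = nj 3 F - 2 := by omega
            have q2 : nj 1 ((F2.erase a').erase b') = 0 := by omega
            rw [q1, q2]; simp; ring
        · simp at e1 e2 e3 g1 g2 g3
          have n3 : nj 3 F2 = nj 3 F - 1 := by omega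
          have n2 : nj 2 F2 = nj 2 F := by omega
          have n1 : nj 1 F2 = 1 := by omega
          rw [n3, n2, n1, Mf_two (R := F.card - 2) (by omega), hQ]
          have hsub : F.card - 2 - 2 = F.card - 4 := by omega
          have hx : ((F.card - 2 : ℕ) : ℝ) = (F.card : ℝ) - 2 := by
            rw [Nat.cast_sub (by omega)]; norm_num
          have hy : ((nj 3 F - 1 : ℕ) : ℝ) = (nj 3 F : ℝ) - 1 := by
            rw [Nat.cast_sub (by omega)]; norm_num
          rw [hsub, hx, hy]
          have hpos : (0:ℝ) < (F.card : ℝ) - 3 := by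
            have : (9:ℝ) ≤ F.card := by exact_mod_cast hcard
            linarith
          apply le_of_eq
          simp
          field_simp
          ring
      · have hle := fr_le F b.1
        have hpos := fr_pos hbF
        have hn1 : fr F b.1 ≠ 1 := by
          intro h
          have : 1 ≤ nj 1 F := Finset.card_pos.2 ⟨b.1, by simpa using h⟩
          omega
        have h2 : fr F b.1 = 2 := by omega
        refine (blk b hb1 (by rw [mem_Ub]; exact h3)).trans (le_of_eq ?_)
        rw [h2] at g1 g2 g3 ⊢
        simp at e1 e2 e3 g1 g2 g3
        have q1 : nj 3 ((F.erase a).erase b) = nj 3 F := by omega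
        have q2 : nj 1 ((F.erase a).erase b) = 2 := by omega
        rw [q1, q2, hE]; simp
    have S2 := Finset.sum_le_sum B2
    rw [← Finset.mul_sum] at S2
    have S3 := sum_fr F E
    rw [← Finset.add_sum_erase _ _ ha, ← Finset.add_sum_erase _ _ ha', haa, h1] at S3
    have hpot := hP.two (nj 3 F) (nj 2 F) F.card hw hn3 hp (by omega)
    rw [← hQ] at hpot
    rw [Mf_two (R := F.card) (by omega), hq0]
    refine (add_le_add B1 S2).trans ?_
    rw [← mul_add, mul_assoc]
    apply mul_le_mul_of_nonneg_left _ hMpos2.le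
    refine le_trans (le_of_eq ?_) hpot
    have : ∑ x ∈ (F.erase a).erase a', E (fr F x.1) = 
      3 * nj 3 F * E 3 + 2 * nj 2 F * E 2 + nj 1 F * E 1 - E 2 - E 2 := by linarith
    rw [this, hq0]
    simp [hE]
    ring
  · -- restart
    have hp0 : nj 2 F = 0 := by omega
    obtain ⟨a, ha, h1⟩ := exists_fr (F := F) (j := 3) (by norm_num) (by omega)
    rw [expose hC ha]
    have B : ∀ b ∈ F.erase a, 
        ∑ σ ∈ cell ((F.erase a).erase b) (upd τ a b), Real.exp (lam * cost (gr σ) (Ub F)) ≤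
        Mf (F.card - 2) * (if b.1 = a.1 then Real.exp (3 * lam) * Ψ (nj 3 F - 1) (F.card - 2) 1
          else Real.exp (3 * lam) * Ψ (nj 3 F - 2) (F.card - 2) 0) := by
      intro b hb
      have hbF := Finset.mem_of_mem_erase hb
      have hba := Finset.ne_of_mem_erase hb
      have step : ∑ σ ∈ cell ((F.erase a).erase b) (upd τ a b), 
        Real.exp (lam * cost (gr σ) (Ub F)) ≤ Real.exp (3 * lam) * ∑ σ ∈ cell ((F.erase a).erase b) (upd τ a b), 
        Real.exp (lam * cost (gr σ) (Ub ((F.erase a).erase b))) := by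
        rw [Finset.mul_sum]
        apply Finset.sum_le_sum
        intro σ hσ
        obtain ⟨hσ', hab⟩ := cell_sub hC ha hb hσ
        rw [← Real.exp_add]
        apply Real.exp_le_exp.2
        have : (cost (gr σ) (Ub F) : ℝ) ≤ cost (gr σ) (Ub ((F.erase a).erase b)) + 3 := by
          exact_mod_cast cost_restart (mem_cell.1 hσ').1 ha hbF hab
        nlinarith
      refine (step.trans (mul_le_mul_of_nonneg_left (IH a b ha hb) (Real.exp_nonneg _))).trans ?_
      apply le_of_eq
      have hle := fr_le F b.1
      have hpos := fr_pos hbF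
      have h3 : fr F b.1 = 3 := by
        have k1 : fr F b.1 ≠ 1 := by
          intro h
          have : 1 ≤ nj 1 F := Finset.card_pos.2 ⟨b.1, by simpa using h⟩
          omega
        have k2 : fr F b.1 ≠ 2 := by
          intro h
          have : 1 ≤ nj 2 F := Finset.card_pos.2 ⟨b.1, by simpa using h⟩
          omega
        omega
      have e1 := nj_erase ha 1
      have e3 := nj_erase ha 3
      have g1 := nj_erase hb 1
      have g3 := nj_erase hb 3
      rw [fr_erase ha, h3] at g1 g3
      rw [h1] at e1 e3
      split_ifs with hab
      · simp [hab] at *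
        have q1 : nj 3 ((F.erase a).erase b) = nj 3 F - 1 := by omega
        have q2 : nj 1 ((F.erase a).erase b) = 1 := by omega
        rw [q1, q2]; ring
      · simp [hab] at *
        have q1 : nj 3 ((F.erase a).erase b) = nj 3 F - 2 := by omega
        have q2 : nj 1 ((F.erase a).erase b) = 0 := by omega
        rw [q1, q2]; ring
    refine (Finset.sum_le_sum B).trans ?_
    rw [← Finset.mul_sum, Mf_two (R := F.card) (by omega), hq0, mul_assoc]
    apply mul_le_mul_of_nonneg_left _ hMpos2.le
    have hpot := hP.three (nj 3 F) F.card hw hn3 (by omega)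
    refine le_trans (le_of_eq ?_) hpot
    rw [Finset.sum_ite, Finset.sum_const, Finset.sum_const]
    have c1 : ((F.erase a).filter (fun b => b.1 = a.1)).card = 2 := by
      have h2 : fr (F.erase a) a.1 = 2 := by rw [fr_erase ha, if_pos rfl, h1]
      rw [← h2]
      unfold fr
      symm
      apply Finset.card_bij (fun i _ => (a.1, i))
      · intro i hi; simpa using hi
      · intro i _ j _ h; simpa using h
      · rintro ⟨v, i⟩ h
        simp only [Finset.mem_filter] at h
        obtain ⟨h, rfl⟩ := h
        exact ⟨i, by simpa using h, rfl⟩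
    have c2 := Finset.card_filter_add_card_filter_not (s := F.erase a) (fun b => b.1 = a.1)
    rw [c1, Finset.card_erase_of_mem ha] at c2
    have c3 : (((F.erase a).filter (fun b => ¬ b.1 = a.1)).card : ℝ) = 3 * ((nj 3 F : ℝ) - 1) := by
      have : ((F.erase a).filter (fun b => ¬ b.1 = a.1)).card + 3 = 3 * nj 3 F := by omega
      have : ((((F.erase a).filter (fun b => ¬ b.1 = a.1)).card + 3 : ℕ) : ℝ) = ((3 * nj 3 F : ℕ) : ℝ) := by rw [this]
      push_cast at this
      linarith
    rw [c1, nsmul_eq_mul, nsmul_eq_mul, c3]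
    norm_num

end main

section analysis

noncomputable def fA (w R q : ℝ) : ℝ := (27 * w ^ 3 - 45 * w ^ 2 * q + 30 * w * q ^ 2) / (10 * R ^ 2)

noncomputable def gA (a b : ℝ) : ℝ := (27 * a ^ 3 - 45 * a ^ 2 * b + 30 * a * b ^ 2) / 10

noncomputable def LA (i j k a b : ℝ) : ℝ :=
  -i * (81 * a ^ 2 - 90 * a * b + 30 * b ^ 2) / 10 + k * (-45 * a ^ 2 + 60 * a * b) / 10
    + 2 * j * gA a b

noncomputable def HA (i j k a b e : ℝ) : ℝ :=
  (81 * a * i ^ 2 - 45 * (i ^ 2 * b - 2 * a * i * k) + 30 * (a * k ^ 2 - 2 * i * b * k)) / 10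
    + e * (-27 * i ^ 3 - 45 * i ^ 2 * k - 30 * i * k ^ 2) / 10
    - j ^ 2 * gA a b + 2 * j * LA i j k a b - e * j ^ 2 * LA i j k a b

lemma HA_eq (i j k a b e : ℝ) :
    gA (a - i * e) (b + k * e) - (gA a b + e * LA i j k a b) * (1 - j * e) ^ 2
      = e ^ 2 * HA i j k a b e := by
  unfold HA LA gA; ring

lemma HA_bound (i j k : ℝ) : ∃ C, 0 < C ∧ ∀ a b e : ℝ, 0 ≤ a → a ≤ 1 → 0 ≤ b → b ≤ 1 →
    0 ≤ e → e ≤ 1 → |HA i j k a b e| ≤ C ∧ |LA i j k a b| ≤ C := by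
  have hc : IsCompact (Set.Icc (0:ℝ) 1 ×ˢ Set.Icc (0:ℝ) 1 ×ˢ Set.Icc (0:ℝ) 1) :=
    isCompact_Icc.prod (isCompact_Icc.prod isCompact_Icc)
  obtain ⟨C, hC⟩ := hc.exists_bound_of_continuousOn (f := fun x : ℝ × ℝ × ℝ => HA i j k x.1 x.2.1 x.2.2)
    (by unfold HA LA gA; fun_prop)
  obtain ⟨D, hD⟩ := hc.exists_bound_of_continuousOn (f := fun x : ℝ × ℝ × ℝ => LA i j k x.1 x.2.1)
    (by unfold LA gA; fun_prop)
  refine ⟨|C| + |D| + 1, by positivity, ?_⟩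
  intro a b e h1 h2 h3 h4 h5 h6
  have m : (a, b, e) ∈ (Set.Icc (0:ℝ) 1 ×ˢ Set.Icc (0:ℝ) 1 ×ˢ Set.Icc (0:ℝ) 1) :=
    ⟨⟨h1, h2⟩, ⟨h3, h4⟩, ⟨h5, h6⟩⟩
  have c1 := hC _ m
  have c2 := hD _ m
  simp only [Real.norm_eq_abs] at c1 c2
  have := le_abs_self C
  have := le_abs_self D
  have := abs_nonneg C
  have := abs_nonneg D
  constructor <;> linarith

lemma taylor (i j k : ℝ) (hj0 : 0 ≤ j) (hj : j ≤ 4) : ∃ C, 0 < C ∧ ∀ w R q : ℝ, 0 ≤ w → w ≤ R →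
    0 ≤ q → q ≤ R → 8 ≤ R →
    |fA (w - i) (R - j) (q + k) - fA w R q - LA i j k (w / R) (q / R)| ≤ C / R ∧
      |LA i j k (w / R) (q / R)| ≤ C := by
  obtain ⟨C, hC, h⟩ := HA_bound i j k
  refine ⟨4 * C, by positivity, ?_⟩
  intro w R q h1 h2 h3 h4 h5
  have hR : 0 < R := by linarith
  have hh := h (w / R) (q / R) (1 / R) (by positivity) ((div_le_one hR).2 h2) (by positivity)
    ((div_le_one hR).2 h4) (by positivity) ((div_le_one hR).2 (by linarith))
  have hRj : 0 < R - j := by linarith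
  refine ⟨?_, by linarith⟩
  have e := HA_eq i j k (w / R) (q / R) (1 / R)
  have e1 : fA (w - i) (R - j) (q + k) = R * gA (w / R - i * (1 / R)) (q / R + k * (1 / R)) / (1 - j * (1 / R)) ^ 2 := by
    unfold fA gA
    have : 1 - j * (1 / R) = (R - j) / R := by field_simp
    rw [this]
    field_simp
  have e2 : fA w R q = R * gA (w / R) (q / R) := by
    unfold fA gA; field_simp
  have hs : (1:ℝ) / 2 ≤ 1 - j * (1 / R) := by
    have : j * (1 / R) ≤ 1 / 2 := by
      rw [mul_one_div, div_le_div_iff₀ hR (by norm_num)]; linarith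
    linarith
  have hs2 : (1:ℝ) / 4 ≤ (1 - j * (1 / R)) ^ 2 := by nlinarith
  have hs3 : (0:ℝ) < (1 - j * (1 / R)) ^ 2 := by linarith
  have e3 : fA (w - i) (R - j) (q + k) - fA w R q - LA i j k (w / R) (q / R)
      = (1 / R) * HA i j k (w / R) (q / R) (1 / R) / (1 - j * (1 / R)) ^ 2 := by
    rw [e1, e2, eq_div_iff hs3.ne', sub_mul, sub_mul, div_mul_cancel₀ _ hs3.ne']
    have : (1 / R) * HA i j k (w / R) (q / R) (1 / R) = R * ((1 / R) ^ 2 * HA i j k (w / R) (q / R) (1 / R)) := by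
      field_simp
    rw [this, ← e]
    have : R * (1 / R) = 1 := by field_simp
    linear_combination (LA i j k (w / R) (q / R) * (1 - j * (1 / R)) ^ 2) * this
  rw [e3, abs_div, abs_mul, abs_of_pos hs3, abs_of_pos (show 0 < 1 / R by positivity), div_le_div_iff₀ hs3 hR]
  have : 1 / R * |HA i j k (w / R) (q / R) (1 / R)| * R = |HA i j k (w / R) (q / R) (1 / R)| := by
    field_simp
  rw [this]
  nlinarith [hh.1]

lemma exp_quad {x : ℝ} (h : |x| ≤ 1) : Real.exp x ≤ 1 + x + x ^ 2 := by
  have := Real.abs_exp_sub_one_sub_id_le h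
  have := (abs_le.1 this).2
  linarith

lemma exp4 {p1 p2 p3 p4 y1 y2 y3 y4 K κ lam : ℝ} (h1 : 0 ≤ p1) (h2 : 0 ≤ p2) (h3 : 0 ≤ p3)
    (h4 : 0 ≤ p4) (hK : 0 < K) (hk : 0 < κ) (k1 : |y1| ≤ K) (k2 : |y2| ≤ K) (k3 : |y3| ≤ K) (k4 : |y4| ≤ K)
    (hl : 0 < lam) (hl1 : lam * K ≤ 1) (hl2 : lam * K ^ 2 ≤ κ)
    (hs : p1 * y1 + p2 * y2 + p3 * y3 + p4 * y4 ≤ - κ * (p1 + p2 + p3 + p4)) :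
    p1 * Real.exp (lam * y1) + p2 * Real.exp (lam * y2) + p3 * Real.exp (lam * y3)
      + p4 * Real.exp (lam * y4) ≤ p1 + p2 + p3 + p4 := by
  have key : ∀ y, |y| ≤ K → Real.exp (lam * y) ≤ 1 + lam * y + lam * κ := by
    intro y hy
    have : |lam * y| ≤ 1 := by
      rw [abs_mul, abs_of_pos hl]
      exact (mul_le_mul_of_nonneg_left hy hl.le).trans hl1
    refine (exp_quad this).trans ?_
    have : y ^ 2 ≤ K ^ 2 := by rw [← sq_abs]; gcongr
    have : (lam * y) ^ 2 ≤ lam * κ := by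
      calc (lam * y) ^ 2 = lam * (lam * y ^ 2) := by ring
        _ ≤ lam * (lam * K ^ 2) := by gcongr
        _ ≤ _ := by gcongr
    linarith
  have a1 := mul_le_mul_of_nonneg_left (key y1 k1) h1
  have a2 := mul_le_mul_of_nonneg_left (key y2 k2) h2
  have a3 := mul_le_mul_of_nonneg_left (key y3 k3) h3
  have a4 := mul_le_mul_of_nonneg_left (key y4 k4) h4
  have a5 := mul_le_mul_of_nonneg_left hs hl.le
  nlinarith

lemma drift_one (a b : ℝ) : 3 * a * LA 1 2 (-1) a b + (1 - 3 * a - b) * LA 0 2 0 a b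
    + b * LA 0 2 (-2) a b = - 9 * a * b ^ 2 := by
  unfold LA gA; ring

lemma drift_two (a : ℝ) : (1 - 3 * a) * LA 0 2 2 a 0 + 3 * a * (3 * a * (LA 2 4 0 a 0 + 1)
    + (1 - 3 * a) * LA 1 4 1 a 0) = 0 := by
  unfold LA gA; ring

lemma drift_three : LA 2 2 0 (1 / 3) 0 = - 7 / 5 := by
  unfold LA gA; norm_num

end analysis

section analysis2

def TB (C i j k : ℝ) : Prop := ∀ w R q : ℝ, 0 ≤ w → w ≤ R →
    0 ≤ q → q ≤ R → 8 ≤ R →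
    |fA (w - i) (R - j) (q + k) - fA w R q - LA i j k (w / R) (q / R)| ≤ C / R ∧
      |LA i j k (w / R) (q / R)| ≤ C

lemma TB.mono {C D i j k : ℝ} (h : TB C i j k) (hCD : C ≤ D) : TB D i j k := by
  intro w R q h1 h2 h3 h4 h5
  obtain ⟨a, b⟩ := h w R q h1 h2 h3 h4 h5
  have : C / R ≤ D / R := by gcongr
  exact ⟨a.trans this, b.trans hCD⟩

lemma exists_TB : ∃ C, 0 < C ∧ TB C 1 2 (-1) ∧ TB C 0 2 0 ∧ TB C 0 2 (-2) ∧ TB C 0 2 2 ∧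
    TB C 2 4 0 ∧ TB C 1 4 1 ∧ TB C 2 2 0 ∧ TB C 1 2 1 := by
  obtain ⟨c1, p1, h1⟩ := taylor 1 2 (-1) (by norm_num) (by norm_num)
  obtain ⟨c2, p2, h2⟩ := taylor 0 2 0 (by norm_num) (by norm_num)
  obtain ⟨c3, p3, h3⟩ := taylor 0 2 (-2) (by norm_num) (by norm_num)
  obtain ⟨c4, p4, h4⟩ := taylor 0 2 2 (by norm_num) (by norm_num)
  obtain ⟨c5, p5, h5⟩ := taylor 2 4 0 (by norm_num) (by norm_num)
  obtain ⟨c6, p6, h6⟩ := taylor 1 4 1 (by norm_num) (by norm_num)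
  obtain ⟨c7, p7, h7⟩ := taylor 2 2 0 (by norm_num) (by norm_num)
  obtain ⟨c8, p8, h8⟩ := taylor 1 2 1 (by norm_num) (by norm_num)
  refine ⟨c1 + c2 + c3 + c4 + c5 + c6 + c7 + c8, by positivity, TB.mono h1 ?_, TB.mono h2 ?_,
    TB.mono h3 ?_, TB.mono h4 ?_, TB.mono h5 ?_, TB.mono h6 ?_, TB.mono h7 ?_, TB.mono h8 ?_⟩ <;> linarith

/-- consequence of the Taylor bound -/
lemma TB.use {C i j k : ℝ} (hC : 0 < C) (h : TB C i j k) {w R q : ℝ} (h1 : 0 ≤ w) (h2 : w ≤ R)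
    (h3 : 0 ≤ q) (h4 : q ≤ R) (h5 : 8 ≤ R) :
    fA (w - i) (R - j) (q + k) - fA w R q ≤ LA i j k (w / R) (q / R) + C / R ∧
    |fA (w - i) (R - j) (q + k) - fA w R q| ≤ 2 * C ∧ |LA i j k (w / R) (q / R)| ≤ C := by
  obtain ⟨a, b⟩ := h w R q h1 h2 h3 h4 h5
  have hle : C / R ≤ C := div_le_self hC.le (by linarith)
  rw [abs_le] at a b
  refine ⟨by linarith, ?_, abs_le.2 b⟩
  rw [abs_le]; constructor <;> linarith

lemma real_one {C : ℝ} (hC : 0 < C) (t1 : TB C 1 2 (-1)) (t2 : TB C 0 2 0) (t3 : TB C 0 2 (-2))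
    {w p q R i2 i3 : ℝ} (hw : 0 ≤ w) (hp : 0 ≤ p) (hq : 1 ≤ q) (hR : R = 3 * w + 2 * p + q)
    (h8 : 8 ≤ R) (hi2 : 2 * p * i2 = 0) (hi3 : (q - 1) * i3 ≤ 1) :
    3 * w * (fA (w - 1) (R - 2) (q - 1) - fA w R q - 2 * (1 / 100)) +
    2 * p * (fA w (R - 2) q - fA w R q - 2 * (1 / 100) + 3 * i2) +
    (q - 1) * (fA w (R - 2) (q - 2) - fA w R q - 2 * (1 / 100) + 3 * i3) ≤
      2 * C + 3 - 2 * (1 / 100) * (R - 1) := by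
  have u1 := (t1.use hC hw (by linarith : w ≤ R) (by linarith : 0 ≤ q) (by linarith) h8).1
  have u2 := (t2.use hC hw (by linarith : w ≤ R) (by linarith : 0 ≤ q) (by linarith) h8).1
  have u3' := (t3.use hC hw (by linarith : w ≤ R) (by linarith : 0 ≤ q) (by linarith) h8)
  have u3 := u3'.1
  have v3 := (abs_le.1 u3'.2.2).1
  have hd := drift_one (w / R) (q / R)
  simp only [sub_zero, add_zero, ← sub_eq_add_neg] at u1 u2 u3
  have hR0 : 0 < R := by linarith
  have hsum : 3 * w * LA 1 2 (-1) (w / R) (q / R) + 2 * p * LA 0 2 0 (w / R) (q / R)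
      + q * LA 0 2 (-2) (w / R) (q / R) ≤ 0 := by
    have e : 3 * w * LA 1 2 (-1) (w / R) (q / R) + 2 * p * LA 0 2 0 (w / R) (q / R)
      + q * LA 0 2 (-2) (w / R) (q / R) = R * (- 9 * (w / R) * (q / R) ^ 2) := by
      rw [← hd]
      have e1 : 2 * p = R * (1 - 3 * (w / R) - q / R) := by field_simp; linarith
      have e2 : w = R * (w / R) := by field_simp
      have e3 : q = R * (q / R) := by field_simp
      generalize LA 1 2 (-1) (w / R) (q / R) = A
      generalize LA 0 2 0 (w / R) (q / R) = B
      generalize LA 0 2 (-2) (w / R) (q / R) = D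
      linear_combination 3 * A * e2 + B * e1 + D * e3
    rw [e]
    have : 0 ≤ (w / R) * (q / R) ^ 2 := by positivity
    nlinarith
  have a1 := mul_le_mul_of_nonneg_left u1 (show 0 ≤ 3 * w by linarith)
  have a2 := mul_le_mul_of_nonneg_left u2 (show 0 ≤ 2 * p by linarith)
  have a3 := mul_le_mul_of_nonneg_left u3 (show 0 ≤ q - 1 by linarith)
  have a4 : (R - 1) * (C / R) ≤ C := by
    rw [mul_div_assoc', div_le_iff₀ hR0]; nlinarith
  have a5 : 3 * w * (C / R) + 2 * p * (C / R) + (q - 1) * (C / R) ≤ C := by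
    refine le_trans (le_of_eq ?_) a4
    rw [hR]; ring
  rw [hR]
  rw [hR] at *
  linarith

lemma real_two {C : ℝ} (hC : 0 < C) (t1 : TB C 0 2 0) (t2 : TB C 0 2 2) (t3 : TB C 2 4 0)
    (t4 : TB C 1 4 1)
    {w p R i1 i2 : ℝ} (hw : 1 ≤ w) (hp : 1 ≤ p) (hR : R = 3 * w + 2 * p)
    (h8 : 8 ≤ R) (hi1 : i1 ≤ 1) (hi2 : (2 * p - 2) * i2 = 0) :
    1 * (fA w (R - 2) 0 - fA w R 0 - 2 * (1 / 100) + 3 * i1) +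
    (2 * p - 2) * (fA w (R - 2) 2 - fA w R 0 - 2 * (1 / 100) + 3 * i2) +
    3 * w * (3 * (w - 1)) / (R - 3) * (fA (w - 2) (R - 4) 0 - fA w R 0 - 4 * (1 / 100) + 1) +
    3 * w * (2 * p) / (R - 3) * (fA (w - 1) (R - 4) 1 - fA w R 0 - 4 * (1 / 100)) ≤
      20 * C + 20 - 2 * (1 / 100) * (R - 1) := by
  have hw0 : 0 ≤ w := by linarith
  have x1 := t1.use hC hw0 (by linarith : w ≤ R) (le_refl (0:ℝ)) (by linarith) h8
  have x2 := t2.use hC hw0 (by linarith : w ≤ R) (le_refl (0:ℝ)) (by linarith) h8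
  have x3 := t3.use hC hw0 (by linarith : w ≤ R) (le_refl (0:ℝ)) (by linarith) h8
  have x4 := t4.use hC hw0 (by linarith : w ≤ R) (le_refl (0:ℝ)) (by linarith) h8
  simp only [sub_zero, add_zero, zero_add, zero_div] at x1 x2 x3 x4
  have hd := drift_two (w / R)
  have hR0 : 0 < R := by linarith
  have hR3 : 0 < R - 3 := by linarith
  obtain ⟨u1, -, v1⟩ := x1
  obtain ⟨u2, -, v2⟩ := x2
  obtain ⟨u3, -, v3⟩ := x3
  obtain ⟨u4, -, v4⟩ := x4
  generalize LA 0 2 0 (w / R) 0 = A at *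
  generalize LA 0 2 2 (w / R) 0 = B at *
  generalize LA 2 4 0 (w / R) 0 = D at *
  generalize LA 1 4 1 (w / R) 0 = E at *
  rw [abs_le] at v1 v2 v3 v4
  have hW : 3 * w * (3 * (w - 1)) / (R - 3) + 3 * w * (2 * p) / (R - 3) = 3 * w := by
    field_simp; rw [hR]; ring
  have hn1 : 0 ≤ 3 * w * (3 * (w - 1)) / (R - 3) := by
    apply div_nonneg _ hR3.le
    apply mul_nonneg <;> linarith
  have hn2 : 0 ≤ 3 * w * (2 * p) / (R - 3) := by
    apply div_nonneg _ hR3.le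
    apply mul_nonneg <;> linarith
  have hsum : (2 * p - 2) * B + 3 * w * (3 * (w - 1)) / (R - 3) * (D + 1) +
      3 * w * (2 * p) / (R - 3) * E = - 2 * B + 9 * w * (2 * p) / (R * (R - 3)) * (E - D - 1) := by
    have e0 : R * ((1 - 3 * (w / R)) * B + 3 * (w / R) * (3 * (w / R) * (D + 1) + (1 - 3 * (w / R)) * E)) = 0 := by
      rw [hd, mul_zero]
    have e1 : 2 * p = R - 3 * w := by linarith
    rw [e1]
    rw [← sub_eq_zero]
    rw [← e0]
    field_simp
    ring
  have hcoef : 0 ≤ 9 * w * (2 * p) / (R * (R - 3)) := by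
    apply div_nonneg
    · apply mul_nonneg <;> linarith
    · positivity
  have hcoef2 : 9 * w * (2 * p) / (R * (R - 3)) ≤ 6 := by
    rw [div_le_iff₀ (by positivity)]
    have e1 : 2 * p = R - 3 * w := by linarith
    rw [e1]
    nlinarith
  have hlast : 9 * w * (2 * p) / (R * (R - 3)) * (E - D - 1) ≤ 12 * C := by
    have : E - D - 1 ≤ 2 * C := by linarith
    calc _ ≤ 9 * w * (2 * p) / (R * (R - 3)) * (2 * C) := by gcongr
      _ ≤ 6 * (2 * C) := by gcongr
      _ = _ := by ring
  have a2 := mul_le_mul_of_nonneg_left u2 (show 0 ≤ 2 * p - 2 by linarith)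
  have a3 := mul_le_mul_of_nonneg_left u3 hn1
  have a4 := mul_le_mul_of_nonneg_left u4 hn2
  have a6 : (R - 1) * (C / R) ≤ C := by
    rw [mul_div_assoc', div_le_iff₀ hR0]; nlinarith
  generalize 3 * w * (3 * (w - 1)) / (R - 3) = P3 at *
  generalize 3 * w * (2 * p) / (R - 3) = P4 at *
  generalize 9 * w * (2 * p) / (R * (R - 3)) * (E - D - 1) = Z at *
  have a5 : C / R + (2 * p - 2) * (C / R) + P3 * (C / R) + P4 * (C / R) ≤ C := by
    refine le_trans (le_of_eq ?_) a6
    have : R - 1 = 1 + (2 * p - 2) + P3 + P4 := by linarith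
    rw [this]; ring
  have hW' : R - 1 = 1 + (2 * p - 2) + P3 + P4 := by linarith
  rw [hW']
  linarith

lemma real_three {C : ℝ} (hC : 0 < C) (t1 : TB C 1 2 1) (t2 : TB C 2 2 0) 
    {w R : ℝ} (hw : 1 ≤ w) (hR : R = 3 * w) (h8 : 8 ≤ R) :
    2 * (fA (w - 1) (R - 2) 1 - fA w R 0 - 2 * (1 / 100)) +
    3 * (w - 1) * (fA (w - 2) (R - 2) 0 - fA w R 0 - 2 * (1 / 100)) ≤
      20 * C + 20 - 2 * (1 / 100) * (R - 1) := by
  have hw0 : 0 ≤ w := by linarith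
  have x1 := t1.use hC hw0 (by linarith : w ≤ R) (le_refl (0:ℝ)) (by linarith) h8
  have x2 := t2.use hC hw0 (by linarith : w ≤ R) (le_refl (0:ℝ)) (by linarith) h8
  simp only [sub_zero, add_zero, zero_add, zero_div] at x1 x2
  have hR0 : 0 < R := by linarith
  have e : w / R = 1 / 3 := by rw [hR]; field_simp
  obtain ⟨-, u1, -⟩ := x1
  obtain ⟨u2, -, -⟩ := x2
  rw [e, drift_three] at u2
  rw [abs_le] at u1
  have a2 := mul_le_mul_of_nonneg_left u2 (show 0 ≤ 3 * (w - 1) by linarith)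
  have a6 : 3 * (w - 1) * (C / R) ≤ C := by
    rw [mul_div_assoc', div_le_iff₀ hR0]; nlinarith
  rw [hR] at *
  linarith

lemma fA_nonneg {w R q : ℝ} (hw : 0 ≤ w) : 0 ≤ fA w R q := by
  unfold fA
  apply div_nonneg _ (by positivity)
  have : 0 ≤ 27 * w ^ 2 - 45 * w * q + 30 * q ^ 2 := by nlinarith [sq_nonneg (w - q), sq_nonneg (27 * w - 22.5 * q)]
  nlinarith [mul_nonneg hw this]

noncomputable def Phi (w0 w R q : ℕ) : ℝ :=
  fA w R q + 1 / 100 * R + 3 * (if R = 3 * w then 1 else 0) + 2 * w0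

set_option maxHeartbeats 2000000 in
theorem pot_exists : ∃ lam : ℝ, 0 < lam ∧ ∃ w0 : ℕ, 2 ≤ w0 ∧ 
    ∀ N, Pot lam w0 N (fun w R q => Real.exp (lam * Phi w0 w R q)) := by
  obtain ⟨C, hC, t1, t2, t3, t4, t5, t6, t7, t8⟩ := exists_TB
  set K := 2 * C + 8 with hK
  have hKp : 0 < K := by positivity
  obtain ⟨lam, hl, hl1, hl2⟩ : ∃ lam : ℝ, 0 < lam ∧ lam * K ≤ 1 ∧ lam * K ^ 2 ≤ 1 / 100 := by
    refine ⟨1 / (100 * K ^ 2), by positivity, ?_, ?_⟩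
    · rw [div_mul_eq_mul_div, div_le_one (by positivity)]; nlinarith
    · field_simp; norm_num
  set w0 := ⌈100 * (20 * C + 20)⌉₊ + 10 with hw0
  have hw0C : 100 * (20 * C + 20) ≤ w0 := by
    have := Nat.le_ceil (100 * (20 * C + 20))
    rw [hw0]; push_cast; linarith
  have red : ∀ (x y : ℝ), Real.exp (lam * x) = Real.exp (lam * (x - y)) * Real.exp (lam * y) := by
    intro x y; rw [← Real.exp_add]; congr 1; ring
  refine ⟨lam, hl, w0, by omega, fun N => ⟨fun _ _ _ => (Real.exp_pos _).le, ?_, ?_, ?_, ?_⟩⟩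
  · intro w R q h
    apply Real.exp_le_exp.2
    apply mul_le_mul_of_nonneg_left _ hl.le
    unfold Phi
    have : 0 ≤ fA w R q := fA_nonneg (by positivity)
    have : (w:ℝ) ≤ w0 := by exact_mod_cast h
    have : (0:ℝ) ≤ (if R = 3 * w then 1 else 0) := by split_ifs <;> norm_num
    have : (0:ℝ) ≤ R := by positivity
    linarith
  · intro w p q R hw _ hq hR
    have hwr : (w0:ℝ) + 1 ≤ w := by exact_mod_cast hw
    have hqr : (1:ℝ) ≤ q := by exact_mod_cast hq
    have hpr : (0:ℝ) ≤ p := by positivity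
    have hRr : (R:ℝ) = 3 * w + 2 * p + q := by rw [hR]; push_cast; ring
    have c1 : ((w - 1 : ℕ) : ℝ) = w - 1 := by rw [Nat.cast_sub (by omega)]; norm_num
    have c2 : ((R - 2 : ℕ) : ℝ) = R - 2 := by rw [Nat.cast_sub (by omega)]; norm_num
    have c3 : ((q - 1 : ℕ) : ℝ) = q - 1 := by rw [Nat.cast_sub (by omega)]; norm_num
    have h8 : (8:ℝ) ≤ R := by nlinarith
    set i : ℝ := if R - 2 = 3 * w then 1 else 0 with hi
    have hi2 : 2 * (p:ℝ) * i = 0 := by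
      rw [hi]; split_ifs with h
      · have : p = 0 := by omega
        simp [this]
      · simp
    have hi3 : ((q:ℝ) - 1) * i ≤ 1 := by
      rw [hi]; split_ifs with h
      · have : q = 2 := by omega
        rw [this]; norm_num
      · simp
    have hi0 : 0 ≤ i ∧ i ≤ 1 := by rw [hi]; split_ifs <;> norm_num
    have D := real_one hC t1 t2 t3 (by linarith : (0:ℝ) ≤ w) hpr hqr hRr h8 hi2 hi3
    have b1 := (t1.use hC (by linarith : (0:ℝ) ≤ w) (by linarith : (w:ℝ) ≤ R) (by linarith : (0:ℝ) ≤ q) (by linarith) h8).2.1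
    have b2 := (t2.use hC (by linarith : (0:ℝ) ≤ w) (by linarith : (w:ℝ) ≤ R) (by linarith : (0:ℝ) ≤ q) (by linarith) h8).2.1
    have b3 := (t3.use hC (by linarith : (0:ℝ) ≤ w) (by linarith : (w:ℝ) ≤ R) (by linarith : (0:ℝ) ≤ q) (by linarith) h8).2.1
    simp only [sub_zero, add_zero, ← sub_eq_add_neg] at b1 b2 b3
    set y1 := fA (w - 1) (R - 2) (q - 1) - fA w R q - 2 * (1 / 100) with hy1
    set y2 := fA w (R - 2) q - fA w R q - 2 * (1 / 100) + 3 * i with hy2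
    set y3 := fA w (R - 2) (q - 2) - fA w R q - 2 * (1 / 100) + 3 * i with hy3
    have P0 : Phi w0 w R q = fA w R q + 1 / 100 * R + 2 * w0 := by
      unfold Phi; rw [if_neg (by omega)]; ring
    have P1 : Phi w0 (w - 1) (R - 2) (q - 1) - Phi w0 w R q = y1 := by
      rw [P0]; unfold Phi; rw [if_neg (by omega), c1, c2, c3, hy1]; ring
    have P2 : Phi w0 w (R - 2) q - Phi w0 w R q = y2 := by
      rw [P0]; unfold Phi; rw [c2, ← hi, hy2]; ring
    have P3 : ((q:ℝ) - 1) * Real.exp (lam * Phi w0 w (R - 2) (q - 2)) = 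
        (q - 1) * (Real.exp (lam * y3) * Real.exp (lam * Phi w0 w R q)) := by
      rcases Nat.lt_or_ge q 2 with h | h
      · have : q = 1 := by omega
        simp [this]
      · have c4 : ((q - 2 : ℕ) : ℝ) = q - 2 := by rw [Nat.cast_sub (by omega)]; norm_num
        have : Phi w0 w (R - 2) (q - 2) - Phi w0 w R q = y3 := by
          rw [P0]; unfold Phi; rw [c2, c4, ← hi, hy3]; ring
        rw [← this, ← red]
    have X := exp4 (p1 := 3 * w) (p2 := 2 * p) (p3 := q - 1) (p4 := 0) (y1 := y1) (y2 := y2) (y3 := y3)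
      (y4 := 0) (K := K) (κ := 1 / 100) (lam := lam) (by linarith) (by linarith) (by linarith) le_rfl hKp
      (by norm_num)
      (by rw [abs_le] at *; constructor <;> linarith)
      (by rw [abs_le] at *; constructor <;> linarith)
      (by rw [abs_le] at *; constructor <;> linarith) (by simpa using hKp.le) hl hl1 hl2 (by linarith)
    rw [P3, red (Phi w0 (w - 1) (R - 2) (q - 1)) (Phi w0 w R q), P1, 
      red (Phi w0 w (R - 2) q) (Phi w0 w R q), P2]
    have X2 := mul_le_mul_of_nonneg_right X (Real.exp_pos (lam * Phi w0 w R q)).le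
    have : (R:ℝ) - 1 = 3 * w + 2 * p + (q - 1) + 0 := by linarith
    rw [this]
    refine le_trans (le_of_eq ?_) X2
    ring
  · intro w p R hw _ hp hR
    have hwr : (w0:ℝ) + 1 ≤ w := by exact_mod_cast hw
    have hpr : (1:ℝ) ≤ p := by exact_mod_cast hp
    have hRr : (R:ℝ) = 3 * w + 2 * p := by rw [hR]; push_cast; ring
    have c1 : ((w - 1 : ℕ) : ℝ) = w - 1 := by rw [Nat.cast_sub (by omega)]; norm_num
    have c2 : ((R - 2 : ℕ) : ℝ) = R - 2 := by rw [Nat.cast_sub (by omega)]; norm_num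
    have c3 : ((R - 4 : ℕ) : ℝ) = R - 4 := by rw [Nat.cast_sub (by omega)]; norm_num
    have c4 : ((w - 2 : ℕ) : ℝ) = w - 2 := by rw [Nat.cast_sub (by omega)]; norm_num
    have h8 : (8:ℝ) ≤ R := by nlinarith
    set i : ℝ := if R - 2 = 3 * w then 1 else 0 with hi
    have hi2 : (2 * (p:ℝ) - 2) * i = 0 := by
      rw [hi]; split_ifs with h
      · have : p = 1 := by omega
        simp [this]
      · simp
    have hi0 : 0 ≤ i ∧ i ≤ 1 := by rw [hi]; split_ifs <;> norm_num
    have D := real_two hC t2 t4 t5 t6 (by linarith : (1:ℝ) ≤ w) hpr hRr h8 hi0.2 hi2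
    have b1 := (t2.use hC (by linarith : (0:ℝ) ≤ w) (by linarith : (w:ℝ) ≤ R) (le_refl (0:ℝ)) (by linarith) h8).2.1
    have b2 := (t4.use hC (by linarith : (0:ℝ) ≤ w) (by linarith : (w:ℝ) ≤ R) (le_refl (0:ℝ)) (by linarith) h8).2.1
    have b3 := (t5.use hC (by linarith : (0:ℝ) ≤ w) (by linarith : (w:ℝ) ≤ R) (le_refl (0:ℝ)) (by linarith) h8).2.1
    have b4 := (t6.use hC (by linarith : (0:ℝ) ≤ w) (by linarith : (w:ℝ) ≤ R) (le_refl (0:ℝ)) (by linarith) h8).2.1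
    simp only [sub_zero, add_zero, zero_add] at b1 b2 b3 b4
    set y1 := fA w (R - 2) 0 - fA w R 0 - 2 * (1 / 100) + 3 * i with hy1
    set y2 := fA w (R - 2) 2 - fA w R 0 - 2 * (1 / 100) + 3 * i with hy2
    set y3 := fA (w - 2) (R - 4) 0 - fA w R 0 - 4 * (1 / 100) + 1 with hy3
    set y4 := fA (w - 1) (R - 4) 1 - fA w R 0 - 4 * (1 / 100) with hy4
    have P0 : Phi w0 w R 0 = fA w R 0 + 1 / 100 * R + 2 * w0 := by
      unfold Phi; rw [if_neg (by omega)]; push_cast; ring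
    have P1 : Phi w0 w (R - 2) 0 - Phi w0 w R 0 = y1 := by
      rw [P0]; unfold Phi; rw [c2, ← hi, hy1]; push_cast; ring
    have P2 : Phi w0 w (R - 2) 2 - Phi w0 w R 0 = y2 := by
      rw [P0]; unfold Phi; rw [c2, ← hi, hy2]; push_cast; ring
    have P3 : Phi w0 (w - 2) (R - 4) 0 - Phi w0 w R 0 = y3 - 1 := by
      rw [P0]; unfold Phi; rw [if_neg (by omega), c3, c4, hy3]; push_cast; ring
    have P4 : Phi w0 (w - 1) (R - 4) 1 - Phi w0 w R 0 = y4 := by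
      rw [P0]; unfold Phi; rw [if_neg (by omega), c1, c3, hy4]; push_cast; ring
    have hR3 : (0:ℝ) < R - 3 := by linarith
    have hn1 : (0:ℝ) ≤ 3 * w * (3 * (w - 1)) / (R - 3) := by
      apply div_nonneg _ hR3.le
      apply mul_nonneg <;> linarith
    have hn2 : (0:ℝ) ≤ 3 * w * (2 * p) / (R - 3) := by
      apply div_nonneg _ hR3.le
      apply mul_nonneg <;> linarith
    have hW : 3 * (w:ℝ) * (3 * (w - 1)) / (R - 3) + 3 * w * (2 * p) / (R - 3) = 3 * w := by
      field_simp; rw [hRr]; ring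
    have X := exp4 (p1 := 1) (p2 := 2 * p - 2) (p3 := 3 * w * (3 * (w - 1)) / (R - 3)) 
      (p4 := 3 * w * (2 * p) / (R - 3)) (y1 := y1) (y2 := y2) (y3 := y3)
      (y4 := y4) (K := K) (κ := 1 / 100) (lam := lam) (by linarith) (by linarith) hn1 hn2 hKp
      (by norm_num)
      (by rw [abs_le] at *; constructor <;> linarith)
      (by rw [abs_le] at *; constructor <;> linarith)
      (by rw [abs_le] at *; constructor <;> linarith) 
      (by rw [abs_le] at *; constructor <;> linarith) hl hl1 hl2 (by linarith)
    have E3 : Real.exp lam * Real.exp (lam * Phi w0 (w - 2) (R - 4) 0) = 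
        Real.exp (lam * y3) * Real.exp (lam * Phi w0 w R 0) := by
      rw [← Real.exp_add, ← Real.exp_add]; congr 1
      linear_combination lam * P3
    rw [E3, red (Phi w0 w (R - 2) 0) (Phi w0 w R 0), P1, 
      red (Phi w0 w (R - 2) 2) (Phi w0 w R 0), P2, red (Phi w0 (w - 1) (R - 4) 1) (Phi w0 w R 0), P4]
    have X2 := mul_le_mul_of_nonneg_right X (Real.exp_pos (lam * Phi w0 w R 0)).le
    have : (R:ℝ) - 1 = 1 + (2 * p - 2) + 3 * (w:ℝ) * (3 * (w - 1)) / (R - 3) + 3 * w * (2 * p) / (R - 3) := by linarith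
    rw [this]
    refine le_trans (le_of_eq ?_) X2
    ring
  · intro w R hw _ hR
    have hwr : (w0:ℝ) + 1 ≤ w := by exact_mod_cast hw
    have hRr : (R:ℝ) = 3 * w := by rw [hR]; push_cast; ring
    have c1 : ((w - 1 : ℕ) : ℝ) = w - 1 := by rw [Nat.cast_sub (by omega)]; norm_num
    have c2 : ((R - 2 : ℕ) : ℝ) = R - 2 := by rw [Nat.cast_sub (by omega)]; norm_num
    have c4 : ((w - 2 : ℕ) : ℝ) = w - 2 := by rw [Nat.cast_sub (by omega)]; norm_num
    have h8 : (8:ℝ) ≤ R := by nlinarith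
    have D := real_three hC t8 t7 (by linarith : (1:ℝ) ≤ w) hRr h8
    have b1 := (t8.use hC (by linarith : (0:ℝ) ≤ w) (by linarith : (w:ℝ) ≤ R) (le_refl (0:ℝ)) (by linarith) h8).2.1
    have b2 := (t7.use hC (by linarith : (0:ℝ) ≤ w) (by linarith : (w:ℝ) ≤ R) (le_refl (0:ℝ)) (by linarith) h8).2.1
    simp only [sub_zero, add_zero, zero_add] at b1 b2
    set y1 := fA (w - 1) (R - 2) 1 - fA w R 0 - 2 * (1 / 100) with hy1
    set y2 := fA (w - 2) (R - 2) 0 - fA w R 0 - 2 * (1 / 100) with hy2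
    have P0 : Phi w0 w R 0 = fA w R 0 + 1 / 100 * R + 3 + 2 * w0 := by
      unfold Phi; rw [if_pos (by omega)]; push_cast; ring
    have P1 : Phi w0 (w - 1) (R - 2) 1 - Phi w0 w R 0 = y1 - 3 := by
      rw [P0]; unfold Phi; rw [if_neg (by omega), c1, c2, hy1]; push_cast; ring
    have P2 : Phi w0 (w - 2) (R - 2) 0 - Phi w0 w R 0 = y2 - 3 := by
      rw [P0]; unfold Phi; rw [if_neg (by omega), c2, c4, hy2]; push_cast; ring
    have X := exp4 (p1 := 2) (p2 := 3 * (w - 1)) (p3 := 0) (p4 := 0) (y1 := y1) (y2 := y2) (y3 := 0)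
      (y4 := 0) (K := K) (κ := 1 / 100) (lam := lam) (by linarith) (by linarith) le_rfl le_rfl hKp
      (by norm_num)
      (by rw [abs_le] at *; constructor <;> linarith)
      (by rw [abs_le] at *; constructor <;> linarith)
      (by simpa using hKp.le) (by simpa using hKp.le) hl hl1 hl2 (by linarith)
    have E1 : Real.exp (3 * lam) * Real.exp (lam * Phi w0 (w - 1) (R - 2) 1) = 
        Real.exp (lam * y1) * Real.exp (lam * Phi w0 w R 0) := by
      rw [← Real.exp_add, ← Real.exp_add]; congr 1
      linear_combination lam * P1
    have E2 : Real.exp (3 * lam) * Real.exp (lam * Phi w0 (w - 2) (R - 2) 0) = 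
        Real.exp (lam * y2) * Real.exp (lam * Phi w0 w R 0) := by
      rw [← Real.exp_add, ← Real.exp_add]; congr 1
      linear_combination lam * P2
    rw [E1, E2]
    have X2 := mul_le_mul_of_nonneg_right X (Real.exp_pos (lam * Phi w0 w R 0)).le
    have : (R:ℝ) - 1 = 2 + 3 * ((w:ℝ) - 1) + 0 + 0 := by linarith
    rw [this]
    refine le_trans (le_of_eq ?_) X2
    ring

lemma Phi_start (w0 n : ℕ) (hn : 1 ≤ n) : Phi w0 n (3 * n) 0 = 33 / 100 * n + 3 + 2 * w0 := by
  unfold Phi fA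
  rw [if_pos rfl]
  have : (n:ℝ) ≠ 0 := by positivity
  push_cast
  field_simp
  ring

end analysis2

section switching

variable {V : Type*} [Fintype V] [DecidableEq V]

noncomputable def Inv (P : Type*) [Fintype P] [DecidableEq P] : Finset (P → P) := cell Finset.univ id

lemma mem_Inv {P : Type*} [Fintype P] [DecidableEq P] {σ : P → P} : σ ∈ Inv P ↔ IsM σ := by
  simp [Inv, mem_cell]

lemma Cl_univ {P : Type*} [Fintype P] [DecidableEq P] : Cl (Finset.univ : Finset P) id := by
  intro x hx; simp at hx

lemma card_one {P : Type*} [Fintype P] [DecidableEq P] {a b : P} :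
    ((Inv P).filter (fun σ => σ a = b)).card ≤ Mf (Fintype.card P - 2) := by
  by_cases h : b = a
  · have : (Inv P).filter (fun σ => σ a = b) = ∅ := by
      ext σ; simp only [Finset.mem_filter, mem_Inv]
      simp
      intro hM hab
      exact (hM a).2 (hab.trans h)
    rw [this]; simp
  · unfold Inv
    have hb : b ∈ Finset.univ.erase a := by simp [h]
    rw [cell_fiber Cl_univ (Finset.mem_univ a) hb]
    apply card_cell_le _ _ _ (Cl_upd Cl_univ a b)
    rw [Finset.card_erase_of_mem hb, Finset.card_erase_of_mem (Finset.mem_univ a), Finset.card_univ]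
    omega

lemma card_pair {P : Type*} [Fintype P] [DecidableEq P] {a b c d : P} (h1 : c ≠ a) (h2 : b ≠ a)
    (h3 : b ≠ c) (h4 : d ≠ a) (h5 : d ≠ c) (h6 : d ≠ b) :
    ((Inv P).filter (fun σ => σ a = c ∧ σ b = d)).card ≤ Mf (Fintype.card P - 4) := by
  unfold Inv
  have hc : c ∈ Finset.univ.erase a := by simp [h1]
  have hb : b ∈ ((Finset.univ.erase a).erase c) := by simp [h2, h3]
  have hd : d ∈ ((Finset.univ.erase a).erase c).erase b := by simp [h4, h5, h6]
  have : (cell Finset.univ id).filter (fun σ => σ a = c ∧ σ b = d) = 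
      ((cell Finset.univ id).filter (fun σ => σ a = c)).filter (fun σ => σ b = d) := by
    rw [Finset.filter_filter]
  rw [this, cell_fiber Cl_univ (Finset.mem_univ a) hc, cell_fiber (Cl_upd Cl_univ a c) hb hd]
  apply card_cell_le _ _ _ (Cl_upd (Cl_upd Cl_univ a c) b d)
  rw [Finset.card_erase_of_mem hd, Finset.card_erase_of_mem hb, Finset.card_erase_of_mem hc,
    Finset.card_erase_of_mem (Finset.mem_univ a), Finset.card_univ]
  omega

def Bad (σ : V × Fin 3 → V × Fin 3) (a : V × Fin 3) : Prop :=
  (σ a).1 = a.1 ∨ ∃ b, b ≠ a ∧ b.1 = a.1 ∧ (σ b).1 = (σ a).1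

open scoped Classical in
noncomputable def DD (σ : V × Fin 3 → V × Fin 3) : ℕ := (Finset.univ.filter (Bad σ)).card

open scoped Classical in
lemma card_bad (a : V × Fin 3) : ((Inv (V × Fin 3)).filter (fun σ => Bad σ a)).card ≤ 
    3 * Mf (3 * Fintype.card V - 2) + 27 * Fintype.card V * Mf (3 * Fintype.card V - 4) := by
  have hcP : Fintype.card (V × Fin 3) = 3 * Fintype.card V := by simp [mul_comm]
  set A1 : Fin 3 → Finset (V × Fin 3 → V × Fin 3) := fun i => (Inv (V × Fin 3)).filter (fun σ => σ a = (a.1, i)) with hA1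
  set A2 : (Fin 3 × Fin 3) × (V × Fin 3) → Finset (V × Fin 3 → V × Fin 3) := fun x =>
    if x.2.1 ≠ a.1 ∧ (a.1, x.1.1) ≠ a ∧ x.1.2 ≠ x.2.2 then 
    (Inv (V × Fin 3)).filter (fun σ => σ a = x.2 ∧ σ (a.1, x.1.1) = (x.2.1, x.1.2)) else ∅ with hA2
  have hsub : (Inv (V × Fin 3)).filter (fun σ => Bad σ a) ⊆ Finset.univ.biUnion A1 ∪ Finset.univ.biUnion A2 := by
    intro σ hσ
    simp only [Finset.mem_filter, mem_Inv] at hσ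
    obtain ⟨hM, hB⟩ := hσ
    simp only [Finset.mem_union, Finset.mem_biUnion, Finset.mem_univ, true_and]
    by_cases hl : (σ a).1 = a.1
    · left
      refine ⟨(σ a).2, ?_⟩
      simp only [hA1, Finset.mem_filter, mem_Inv]
      refine ⟨hM, ?_⟩
      ext <;> simp [hl]
    · right
      rcases hB with h | ⟨b, hba, hb1, hb2⟩
      · exact absurd h hl
      refine ⟨((b.2, (σ b).2), σ a), ?_⟩
      have eb : (a.1, b.2) = b := by ext <;> simp [hb1]
      have e2 : ((σ a).1, (σ b).2) = σ b := by ext <;> simp [hb2]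
      have hne : σ b ≠ σ a := by
        intro h
        apply hba
        rw [← (hM b).1, h, (hM a).1]
      have h3 : (σ b).2 ≠ (σ a).2 := by
        intro h; apply hne; ext
        · exact hb2
        · rw [h]
      simp only [hA2]
      rw [if_pos ⟨hl, by rw [eb]; exact hba, h3⟩]
      simp only [Finset.mem_filter, mem_Inv, eb, e2]
      exact ⟨hM, trivial, trivial⟩
  refine (Finset.card_le_card hsub).trans ((Finset.card_union_le _ _).trans ?_)
  apply add_le_add
  · refine (Finset.card_biUnion_le_card_mul _ _ (Mf (3 * Fintype.card V - 2)) ?_).trans ?_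
    · intro i _
      have := card_one (a := a) (b := (a.1, i))
      rwa [hcP] at this
    · simp
  · refine (Finset.card_biUnion_le_card_mul _ _ (Mf (3 * Fintype.card V - 4)) ?_).trans ?_
    · intro x _
      simp only [hA2]
      split_ifs with h
      · obtain ⟨h1, h2, h3⟩ := h
        rw [← hcP]
        apply card_pair
        · intro h; apply h1; rw [h]
        · exact h2
        · intro h; apply h1; rw [← h]
        · intro h; apply h1; rw [← h]
        · intro h; apply h3; rw [← h]
        · intro h; apply h1; simp at h; exact h.1
      · simp
    · simp; 
      apply le_of_eq; ring

open scoped Classical in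
lemma sum_DD (hn : 3 ≤ Fintype.card V) : 
    ∑ σ ∈ Inv (V × Fin 3), DD σ ≤ 24 * Mf (3 * Fintype.card V) := by
  have e : ∑ σ ∈ Inv (V × Fin 3), DD σ = ∑ a : V × Fin 3, ((Inv (V × Fin 3)).filter (fun σ => Bad σ a)).card := by
    simp only [DD, Finset.card_filter]
    rw [Finset.sum_comm]
  rw [e]
  refine (Finset.sum_le_card_nsmul _ _ _ (fun a _ => card_bad a)).trans ?_
  simp only [Finset.card_univ, Fintype.card_prod, Fintype.card_fin, smul_eq_mul]
  obtain ⟨k, hk⟩ := Nat.exists_eq_add_of_le' hn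
  rw [hk]
  have h2 : 3 * (k + 3) - 2 = (3 * k + 5) + 2 := by omega
  have h4 : 3 * (k + 3) - 4 = 3 * k + 5 := by omega
  have h0 : 3 * (k + 3) = (3 * k + 5) + 2 + 2 := by omega
  rw [h4, h2, h0]
  rw [show Mf (3 * k + 5 + 2 + 2) = (3 * k + 5 + 2 + 1) * ((3 * k + 5 + 1) * Mf (3 * k + 5)) from rfl,
    show Mf (3 * k + 5 + 2) = (3 * k + 5 + 1) * Mf (3 * k + 5) from rfl]
  generalize Mf (3 * k + 5) = M
  have : ∀ x y : ℕ, x ≤ y → x * M ≤ y * M := fun x y h => Nat.mul_le_mul_right _ h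
  calc _ = ((k + 3) * 3 * (3 * (3 * k + 6) + 27 * (k + 3))) * M := by ring
    _ ≤ (24 * ((3 * k + 8) * (3 * k + 6))) * M := by
      apply this; nlinarith
    _ = _ := by ring

open scoped Classical in
lemma markov (hn : 3 ≤ Fintype.card V) (he : Even (Fintype.card V)) :
    Mf (3 * Fintype.card V) ≤ 2 * ((Inv (V × Fin 3)).filter (fun σ => DD σ ≤ 48)).card := by
  have hc : (Inv (V × Fin 3)).card = Mf (3 * Fintype.card V) := by
    obtain ⟨k, hk⟩ := he
    have := card_cell_eq (3 * k) (Finset.univ : Finset (V × Fin 3)) id Cl_univ (by simp; omega) (by simp)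
    rw [Inv, this]; congr 1; omega
  have h1 := sum_DD hn
  have h2 : ((Inv (V × Fin 3)).filter (fun σ => ¬ DD σ ≤ 48)).card * 49 ≤ ∑ σ ∈ Inv (V × Fin 3), DD σ := by
    calc _ ≤ ∑ σ ∈ (Inv (V × Fin 3)).filter (fun σ => ¬ DD σ ≤ 48), DD σ := by
          rw [← smul_eq_mul]
          apply Finset.card_nsmul_le_sum
          intro σ hσ
          simp at hσ; omega
      _ ≤ _ := Finset.sum_le_sum_of_subset (Finset.filter_subset _ _)
  have h3 := Finset.card_filter_add_card_filter_not (s := Inv (V × Fin 3)) (fun σ => DD σ ≤ 48)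
  omega

lemma Bad_symm {σ : V × Fin 3 → V × Fin 3} {a b : V × Fin 3} (h1 : b ≠ a) (h2 : b.1 = a.1) 
    (h3 : (σ b).1 = (σ a).1) : Bad σ b := Or.inr ⟨a, h1.symm, h2.symm, h3.symm⟩

def conj {P : Type*} [DecidableEq P] (σ : P → P) (b c : P) : P → P := fun x => 
  Equiv.swap b c (σ (Equiv.swap b c x))

lemma conj_conj {P : Type*} [DecidableEq P] (σ : P → P) (b c : P) : conj (conj σ b c) b c = σ := by
  funext x; simp [conj]

lemma conj_IsM {P : Type*} [DecidableEq P] {σ : P → P} (h : IsM σ) (b c : P) : IsM (conj σ b c) := by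
  intro x
  simp only [conj]
  constructor
  · simp [(h _).1]
  · intro h'
    apply (h (Equiv.swap b c x)).2
    exact (Equiv.swap b c).injective (by rw [h']; simp)

open scoped Classical in
lemma switch {σ : V × Fin 3 → V × Fin 3} (h : IsM σ) {a c : V × Fin 3} (ha : Bad σ a)
    (h1 : c.1 ≠ a.1) (h2 : ∀ i, (σ (a.1, i)).1 ≠ c.1) (h3 : (σ c).1 ≠ (σ a).1)
    (h4 : ∀ i, (σ ((σ a).1, i)).1 ≠ (σ c).1) (h5 : (σ c).1 ≠ c.1) :
    DD (conj σ (σ a) c) < DD σ := by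
  obtain ⟨b, hb⟩ : ∃ b, b = σ a := ⟨_, rfl⟩
  obtain ⟨d, hd⟩ : ∃ d, d = σ c := ⟨_, rfl⟩
  have hba : σ b = a := by rw [hb, (h a).1]
  have hdc : σ d = c := by rw [hd, (h c).1]
  rw [← hb] at h3 h4 ⊢
  rw [← hd] at h3 h4 h5
  have nab : a ≠ b := by rw [hb]; exact (h a).2.symm
  have nca : c ≠ a := fun h => h1 (by rw [h])
  have ncb : c ≠ b := by
    intro h; apply h2 a.2; show (σ a).1 = c.1; rw [← hb, h]
  have ndb : d ≠ b := fun h => h3 (by rw [h])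
  have ncd : c ≠ d := fun h => h5 (by rw [h])
  have nad : a ≠ d := by
    intro h'; apply ncb; rw [← hdc, ← h', ← hb]
  set σ' := conj σ b c with hσ'
  have sa : σ' a = c := by
    simp [hσ', conj, Equiv.swap_apply_of_ne_of_ne nab nca.symm, ← hb]
  have sb : σ' b = d := by
    simp [hσ', conj, ← hd, Equiv.swap_apply_of_ne_of_ne ndb ncd.symm]
  have sc : σ' c = a := by
    simp [hσ', conj, hba, Equiv.swap_apply_of_ne_of_ne nab nca.symm]
  have sd : σ' d = b := by
    simp [hσ', conj, Equiv.swap_apply_of_ne_of_ne ndb ncd.symm, hdc]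
  have so : ∀ z, z ≠ a → z ≠ b → z ≠ c → z ≠ d → σ' z = σ z := by
    intro z z1 z2 z3 z4
    simp only [hσ', conj]
    rw [Equiv.swap_apply_of_ne_of_ne z2 z3, Equiv.swap_apply_of_ne_of_ne]
    · intro h'; apply z1; rw [← hba, ← h', (h z).1]
    · intro h'; apply z4; rw [hd, ← h', (h z).1]
  have adj1 : ∀ z, z.1 = a.1 → (σ z).1 ≠ c.1 := by
    intro z hz; have := h2 z.2; rwa [← hz] at this
  have adj2 : ∀ z, z.1 = b.1 → (σ z).1 ≠ d.1 := by
    intro z hz; have := h4 z.2; rwa [← hz] at this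
  have adj1' : ∀ z, z.1 = c.1 → (σ z).1 ≠ a.1 := by
    intro z hz h'; apply adj1 (σ z) h'; rw [(h z).1, hz]
  have adj2' : ∀ z, z.1 = d.1 → (σ z).1 ≠ b.1 := by
    intro z hz h'; apply adj2 (σ z) h'; rw [(h z).1, hz]
  have nca1 : c.1 ≠ b.1 := by
    have := adj1 a rfl; rw [← hb] at this; exact this.symm
  have nda1 : d.1 ≠ a.1 := by
    have := adj2 b rfl; rw [hba] at this; exact this.symm
  have na : ¬ Bad σ' a := by
    rintro (h' | ⟨z, z1, z2, z3⟩)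
    · rw [sa] at h'; exact h1 h'
    · rw [sa] at z3
      by_cases e1 : z = b
      · rw [e1, sb] at z3; exact h5 z3
      by_cases e2 : z = c
      · rw [e2] at z2; exact h1 z2
      by_cases e3 : z = d
      · rw [e3] at z2; exact nda1 z2
      · rw [so z z1 e1 e2 e3] at z3; exact adj1 z z2 z3
  have nb : ¬ Bad σ' b := by
    rintro (h' | ⟨z, z1, z2, z3⟩)
    · rw [sb] at h'; exact h3 h'
    · rw [sb] at z3
      by_cases e1 : z = a
      · rw [e1, sa] at z3; exact h5 z3.symm
      by_cases e2 : z = c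
      · rw [e2] at z2; exact nca1 z2
      by_cases e3 : z = d
      · rw [e3] at z2; exact h3 z2
      · rw [so z e1 z1 e2 e3] at z3; exact adj2 z z2 z3
  have nc : ¬ Bad σ' c := by
    rintro (h' | ⟨z, z1, z2, z3⟩)
    · rw [sc] at h'; exact h1 h'.symm
    · rw [sc] at z3
      by_cases e1 : z = a
      · rw [e1] at z2; exact h1 z2.symm
      by_cases e2 : z = b
      · rw [e2] at z2; exact nca1 z2.symm
      by_cases e3 : z = d
      · rw [e3] at z2; exact h5 z2
      · rw [so z e1 e2 z1 e3] at z3; exact adj1' z z2 z3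
  have nd : ¬ Bad σ' d := by
    rintro (h' | ⟨z, z1, z2, z3⟩)
    · rw [sd] at h'; exact h3 h'.symm
    · rw [sd] at z3
      by_cases e1 : z = a
      · rw [e1] at z2; exact nda1 z2.symm
      by_cases e2 : z = b
      · rw [e2] at z2; exact h3 z2.symm
      by_cases e3 : z = c
      · rw [e3] at z2; exact h5 z2.symm
      · rw [so z e1 e2 e3 z1] at z3; exact adj2' z z2 z3
  unfold DD
  apply Finset.card_lt_card
  rw [Finset.ssubset_iff_of_subset]
  · exact ⟨a, by simpa using ha, by simpa using na⟩
  · intro z hz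
    simp only [Finset.mem_filter, Finset.mem_univ, true_and] at hz ⊢
    have ne : ∀ x, Bad σ' x → x ≠ a ∧ x ≠ b ∧ x ≠ c ∧ x ≠ d := by
      intro x hx
      refine ⟨?_, ?_, ?_, ?_⟩ <;> rintro rfl <;> contradiction
    obtain ⟨z1, z2, z3, z4⟩ := ne z hz
    have ez := so z z1 z2 z3 z4
    rcases hz with h' | ⟨y, y1, y2, y3⟩
    · left; rwa [ez] at h'
    · obtain ⟨x1, x2, x3, x4⟩ := ne y (Bad_symm y1 y2 y3)
      rw [ez, so y x1 x2 x3 x4] at y3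
      exact Or.inr ⟨y, y1, y2, y3⟩

open scoped Classical in
lemma exists_switch {σ : V × Fin 3 → V × Fin 3} (h : IsM σ) (h0 : DD σ ≠ 0) 
    (hn : 24 + DD σ < 3 * Fintype.card V) : ∃ b c, DD (conj σ b c) < DD σ := by
  obtain ⟨a, ha⟩ := Finset.card_pos.1 (Nat.pos_of_ne_zero h0)
  simp only [Finset.mem_filter, Finset.mem_univ, true_and] at ha
  set T : V → Finset V := fun u => insert u (Finset.univ.image (fun i => (σ (u, i)).1)) with hT
  have hTc : ∀ u, (T u).card ≤ 4 := by
    intro u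
    refine (Finset.card_insert_le _ _).trans ?_
    have := Finset.card_image_le (s := (Finset.univ : Finset (Fin 3))) (f := fun i => (σ (u, i)).1)
    simp at this
    omega
  set X := T a.1 ×ˢ (Finset.univ : Finset (Fin 3)) with hX
  set Y := (T (σ a).1 ×ˢ (Finset.univ : Finset (Fin 3))).image σ with hY
  have hXc : X.card ≤ 12 := by
    rw [hX, Finset.card_product]; have := hTc a.1; simp; omega
  have hYc : Y.card ≤ 12 := by
    refine Finset.card_image_le.trans ?_
    rw [Finset.card_product]; have := hTc (σ a).1; simp; omega
  have : ∃ c, c ∉ X ∪ Y ∪ Finset.univ.filter (Bad σ) := by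
    by_contra hcon
    push Not at hcon
    have : Finset.univ ⊆ X ∪ Y ∪ Finset.univ.filter (Bad σ) := fun x _ => hcon x
    have h1 := Finset.card_le_card this
    have h2 := Finset.card_union_le (X ∪ Y) (Finset.univ.filter (Bad σ))
    have h3 := Finset.card_union_le X Y
    have h4 : (Finset.univ.filter (Bad σ)).card = DD σ := rfl
    simp only [Finset.card_univ, Fintype.card_prod, Fintype.card_fin] at h1
    omega
  obtain ⟨c, hc⟩ := this
  simp only [Finset.mem_union, not_or] at hc
  obtain ⟨⟨c1, c2⟩, c3⟩ := hc
  simp only [hX, hT, Finset.mem_product, Finset.mem_univ, and_true, Finset.mem_insert, Finset.mem_image, true_and, not_or,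
    not_exists] at c1
  have c2' : (σ c).1 ∉ T (σ a).1 := by
    intro h'
    apply c2
    rw [hY, Finset.mem_image]
    exact ⟨σ c, by simp [h'], (h c).1⟩
  simp only [hT, Finset.mem_insert, Finset.mem_image, Finset.mem_univ, true_and, not_or, not_exists] at c2'
  simp only [Finset.mem_filter, Finset.mem_univ, true_and] at c3
  refine ⟨σ a, c, switch h ha c1.1 c1.2 c2'.1 c2'.2 ?_⟩
  intro h'; exact c3 (Or.inl h')

open scoped Classical in
lemma card_switch (t : ℕ) (hn : 25 + t < 3 * Fintype.card V) :
    ((Inv (V × Fin 3)).filter (fun σ => DD σ ≤ t + 1)).card ≤ 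
    ((Inv (V × Fin 3)).filter (fun σ => DD σ ≤ t)).card * (1 + (3 * Fintype.card V) ^ 2) := by
  have hsub : (Inv (V × Fin 3)).filter (fun σ => DD σ ≤ t + 1) ⊆ 
      (((Inv (V × Fin 3)).filter (fun σ => DD σ ≤ t)) ×ˢ 
        (Finset.univ : Finset (Option ((V × Fin 3) × (V × Fin 3))))).image
        (fun x => match x.2 with | none => x.1 | some y => conj x.1 y.1 y.2) := by
    intro σ hσ
    simp only [Finset.mem_filter, mem_Inv] at hσ
    rw [Finset.mem_image]
    by_cases h : DD σ ≤ t
    · refine ⟨(σ, none), ?_, rfl⟩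
      simp [mem_Inv, hσ.1, h]
    · obtain ⟨b, c, hbc⟩ := exists_switch hσ.1 (by omega) (by omega)
      refine ⟨(conj σ b c, some (b, c)), ?_, ?_⟩
      · simp [mem_Inv, conj_IsM hσ.1]; omega
      · simp [conj_conj]
  refine (Finset.card_le_card hsub).trans (Finset.card_image_le.trans ?_)
  rw [Finset.card_product]
  apply Nat.mul_le_mul_left
  simp only [Finset.card_univ, Fintype.card_option, Fintype.card_prod, Fintype.card_fin]
  apply le_of_eq; ring

open scoped Classical in
lemma card_switch_all (t : ℕ) (hn : 25 + t < 3 * Fintype.card V) :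
    ((Inv (V × Fin 3)).filter (fun σ => DD σ ≤ t)).card ≤ 
    ((Inv (V × Fin 3)).filter (fun σ => DD σ = 0)).card * (1 + (3 * Fintype.card V) ^ 2) ^ t := by
  induction t with
  | zero => simp
  | succ t ih =>
    refine (card_switch t (by omega)).trans ?_
    refine (Nat.mul_le_mul_right _ (ih (by omega))).trans (le_of_eq ?_)
    ring

open scoped Classical in
lemma simple_lower (hn : 30 ≤ Fintype.card V) (he : Even (Fintype.card V)) :
    Mf (3 * Fintype.card V) ≤ 2 * (((Inv (V × Fin 3)).filter (fun σ => DD σ = 0)).card * 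
      (1 + (3 * Fintype.card V) ^ 2) ^ 48) := 
  (markov (by omega) he).trans (Nat.mul_le_mul_left _ (card_switch_all 48 (by omega)))

end switching

section fibers

variable {V : Type*} [Fintype V] [DecidableEq V]

def toS (G : SimpleGraph V) (e : ∀ v, Fin 3 ≃ G.neighborSet v) : V × Fin 3 → V × Fin 3 := fun x =>
  ((e x.1 x.2 : V), (e (e x.1 x.2 : V)).symm ⟨x.1, (e x.1 x.2).2.symm⟩)

lemma toS_spec {G : SimpleGraph V} {e : ∀ v, Fin 3 ≃ G.neighborSet v} {v u : V} (i : Fin 3)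
    (h : (e v i : V) = u) (j : Fin 3) (h2 : (e u j : V) = v) : toS G e (v, i) = (u, j) := by
  subst h
  unfold toS
  ext
  · rfl
  · simp only
    congr 1
    rw [Equiv.symm_apply_eq]
    exact Subtype.ext h2.symm

lemma toS_fst {G : SimpleGraph V} {e : ∀ v, Fin 3 ≃ G.neighborSet v} (v : V) (i : Fin 3) :
    (toS G e (v, i)).1 = e v i := rfl

lemma toS_IsM {G : SimpleGraph V} (e : ∀ v, Fin 3 ≃ G.neighborSet v) : IsM (toS G e) := by
  rintro ⟨v, i⟩
  have hadj : G.Adj v (e v i) := (e v i).2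
  obtain ⟨j, hj⟩ := (e (e v i)).surjective ⟨v, hadj.symm⟩
  have h1 : toS G e (v, i) = (((e v i : V)), j) := toS_spec i rfl j (by rw [hj])
  have h2 : toS G e ((e v i : V), j) = (v, i) := toS_spec j (by rw [hj]) i rfl
  constructor
  · rw [h1, h2]
  · intro h
    have := congrArg Prod.fst h
    rw [toS_fst] at this
    exact hadj.ne this.symm

lemma toS_gr {G : SimpleGraph V} (e : ∀ v, Fin 3 ≃ G.neighborSet v) : gr (toS G e) = G := by
  ext u v
  rw [gr_adj (toS_IsM e)]
  constructor
  · rintro ⟨h1, i, h2⟩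
    rw [toS_fst] at h2
    rw [← h2]
    exact (e u i).2
  · intro h
    obtain ⟨i, hi⟩ := (e u).surjective ⟨v, h⟩
    exact ⟨h.ne, i, by rw [toS_fst, hi]⟩

lemma toS_inj {G : SimpleGraph V} : Function.Injective (toS G) := by
  intro e e' h
  funext v
  ext i
  have := congrFun h (v, i)
  have := congrArg Prod.fst this
  simpa [toS_fst] using this

lemma simple_equiv {σ : V × Fin 3 → V × Fin 3} (hM : IsM σ) (h0 : DD σ = 0) (v : V) : 
    ∃ e : Fin 3 ≃ (gr σ).neighborSet v, ∀ i, (e i : V) = (σ (v, i)).1 := by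
  classical
  have hb : ∀ a, ¬ Bad σ a := by
    intro a ha
    have := Finset.card_eq_zero.1 h0
    have h1 : a ∈ Finset.univ.filter (Bad σ) := by simpa using ha
    rw [this] at h1
    simp at h1
  have hadj : ∀ i, (gr σ).Adj v (σ (v, i)).1 := by
    intro i
    rw [gr_adj hM]
    exact ⟨fun h => hb (v, i) (Or.inl h.symm), i, rfl⟩
  refine ⟨Equiv.ofBijective (fun i => ⟨(σ (v, i)).1, hadj i⟩) ⟨?_, ?_⟩, fun i => rfl⟩
  · intro i j hij
    by_contra hne
    have : (σ (v, i)).1 = (σ (v, j)).1 := congrArg Subtype.val hij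
    exact hb (v, j) (Or.inr ⟨(v, i), by simpa using hne, rfl, this⟩)
  · rintro ⟨u, hu⟩
    have hu' : (gr σ).Adj v u := hu
    rw [gr_adj hM] at hu'
    obtain ⟨_, i, hi⟩ := hu'
    exact ⟨i, Subtype.ext hi⟩

open scoped Classical in
noncomputable def RG (V : Type*) [Fintype V] : Finset (SimpleGraph V) :=
  Finset.univ.filter (fun G => G.IsRegularOfDegree 3)

open scoped Classical in
lemma card_equivs {G : SimpleGraph V} (hG : G ∈ RG V) : 
    Fintype.card (∀ v, Fin 3 ≃ G.neighborSet v) = 6 ^ Fintype.card V := by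
  simp only [RG, Finset.mem_filter, Finset.mem_univ, true_and] at hG
  rw [Fintype.card_pi]
  rw [Finset.prod_congr rfl (g := fun _ => 6)]
  · simp
  · intro v _
    have h := hG v
    rw [← SimpleGraph.card_neighborSet_eq_degree] at h
    have e : Fin 3 ≃ G.neighborSet v := Fintype.equivOfCardEq (by simp [h])
    rw [Fintype.card_equiv e]
    rfl

lemma gr_mem_RG {σ : V × Fin 3 → V × Fin 3} (hM : IsM σ) (h0 : DD σ = 0) : gr σ ∈ RG V := by
  classical
  simp only [RG, Finset.mem_filter, Finset.mem_univ, true_and]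
  intro v
  obtain ⟨e, _⟩ := simple_equiv hM h0 v
  rw [← SimpleGraph.card_neighborSet_eq_degree, ← Fintype.card_congr e]
  simp

open scoped Classical in
lemma count_lower : ((Inv (V × Fin 3)).filter (fun σ => DD σ = 0)).card ≤ 
    6 ^ Fintype.card V * (RG V).card := by
  apply Finset.card_le_mul_card_image_of_maps_to (f := gr)
  · intro σ hσ
    simp only [Finset.mem_filter, mem_Inv, Finset.mem_coe] at hσ
    exact gr_mem_RG hσ.1 hσ.2
  · intro G hG
    rw [← card_equivs hG, ← Finset.card_univ]
    refine le_trans (Finset.card_le_card ?_) (Finset.card_image_le (f := toS G))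
    intro σ hσ
    simp only [Finset.mem_filter, mem_Inv] at hσ
    obtain ⟨⟨hM, h0⟩, rfl⟩ := hσ
    choose e he using simple_equiv hM h0
    rw [Finset.mem_image]
    refine ⟨e, Finset.mem_univ _, ?_⟩
    funext x
    obtain ⟨v, i⟩ := x
    have := toS_spec (e := e) (v := v) (u := (σ (v, i)).1) i (he v i) (σ (v, i)).2 (by
      rw [he]; show (σ (σ (v, i))).1 = v; rw [(hM _).1])
    rw [this]

open scoped Classical in
lemma count_upper (Q : SimpleGraph V → Prop) : 6 ^ Fintype.card V * ((RG V).filter Q).card ≤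
    ((Inv (V × Fin 3)).filter (fun σ => gr σ ∈ (RG V).filter Q)).card := by
  apply Finset.mul_card_image_le_card_of_maps_to (f := gr)
  · intro σ hσ
    simp only [Finset.mem_filter, Finset.mem_coe] at hσ ⊢
    exact hσ.2
  · intro G hG
    have hG' : G ∈ RG V := (Finset.mem_filter.1 hG).1
    rw [← card_equivs hG', ← Finset.card_univ, ← Finset.card_image_of_injective _ (toS_inj (G := G))]
    apply Finset.card_le_card
    intro σ hσ
    obtain ⟨e, _, rfl⟩ := Finset.mem_image.1 hσ
    simp only [Finset.mem_filter, mem_Inv]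
    rw [toS_gr]
    exact ⟨⟨toS_IsM e, Finset.mem_filter.1 hG⟩, rfl⟩

end fibers

section assembly

open scoped Classical in
noncomputable def badG (V : Type*) [Fintype V] [DecidableEq V] : Finset (SimpleGraph V) :=
  (RG V).filter (fun G => ¬ zeroForcingNumber G ≤ indepNumber G + 1)

section fin
variable {V : Type*} [Fintype V] [DecidableEq V]

lemma fr_univ (v : V) : fr (Finset.univ : Finset (V × Fin 3)) v = 3 := by simp [fr]

lemma exp_moment {lam : ℝ} (hl : 0 ≤ lam) {w0 : ℕ} {Ψ : ℕ → ℕ → ℕ → ℝ} (hw0 : 2 ≤ w0)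
    (hP : Pot lam w0 (Fintype.card V) Ψ) : 
    ∑ σ ∈ Inv (V × Fin 3), Real.exp (lam * cost (gr σ) ∅) ≤ 
      Mf (3 * Fintype.card V) * Ψ (Fintype.card V) (3 * Fintype.card V) 0 := by
  have h := main_bound hl hw0 hP _ (Finset.univ : Finset (V × Fin 3)) id rfl Cl_univ
  have e1 : Ub (Finset.univ : Finset (V × Fin 3)) = ∅ := by
    simp [Ub, fr_univ]
  have e2 : nj 3 (Finset.univ : Finset (V × Fin 3)) = Fintype.card V := by simp [nj, fr_univ, Finset.card_univ]
  have e3 : nj 1 (Finset.univ : Finset (V × Fin 3)) = 0 := by simp [nj, fr_univ]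
  have e4 : (Finset.univ : Finset (V × Fin 3)).card = 3 * Fintype.card V := by
    simp [Finset.card_univ, mul_comm]
  rw [e1, e2, e3, e4] at h
  exact h

open scoped Classical in
lemma bad_count {lam : ℝ} (hl : 0 ≤ lam) {w0 : ℕ} {Ψ : ℕ → ℕ → ℕ → ℝ} (hw0 : 2 ≤ w0)
    (hP : Pot lam w0 (Fintype.card V) Ψ) : 
    (6:ℝ) ^ Fintype.card V * (badG V).card * Real.exp (lam * (Fintype.card V / 3)) ≤ 
      Mf (3 * Fintype.card V) * Ψ (Fintype.card V) (3 * Fintype.card V) 0 := by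
  refine le_trans ?_ (exp_moment hl hw0 hP)
  have h1 := count_upper (V := V) (fun G => ¬ zeroForcingNumber G ≤ indepNumber G + 1)
  have h2 : (6:ℝ) ^ Fintype.card V * (badG V).card ≤ 
    ((Inv (V × Fin 3)).filter (fun σ => gr σ ∈ badG V)).card := by
    have h1' : 6 ^ Fintype.card V * (badG V).card ≤ 
      ((Inv (V × Fin 3)).filter (fun σ => gr σ ∈ badG V)).card := by
      unfold badG
      convert h1
    exact_mod_cast h1'
  calc _ ≤ (((Inv (V × Fin 3)).filter (fun σ => gr σ ∈ badG V)).card : ℝ) * Real.exp (lam * (Fintype.card V / 3)) := by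
        gcongr
    _ = ∑ σ ∈ (Inv (V × Fin 3)).filter (fun σ => gr σ ∈ badG V), Real.exp (lam * (Fintype.card V / 3)) := by
        rw [Finset.sum_const, nsmul_eq_mul]
    _ ≤ ∑ σ ∈ (Inv (V × Fin 3)).filter (fun σ => gr σ ∈ badG V), Real.exp (lam * cost (gr σ) ∅) := by
        apply Finset.sum_le_sum
        intro σ hσ
        simp only [Finset.mem_filter, badG, RG, Finset.mem_univ, true_and] at hσ
        obtain ⟨_, hreg, hbad⟩ := hσ
        apply Real.exp_le_exp.2
        apply mul_le_mul_of_nonneg_left _ hl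
        have : ¬ 3 * cost (gr σ) ∅ ≤ Fintype.card V := by
          intro h
          apply hbad
          apply final_of_cost _ h
          intro v
          exact (hreg v).le
        have : Fintype.card V ≤ 3 * cost (gr σ) ∅ := by omega
        have : (Fintype.card V : ℝ) ≤ 3 * cost (gr σ) ∅ := by exact_mod_cast this
        linarith
    _ ≤ _ := by
        apply Finset.sum_le_sum_of_subset_of_nonneg (Finset.filter_subset _ _)
        intro _ _ _; positivity

end fin

theorem bad_ratio : ∃ b K : ℝ, 0 < b ∧ 0 ≤ K ∧ ∀ n : ℕ, 30 ≤ n → Even n → 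
    0 < (RG (Fin n)).card ∧ 
    ((badG (Fin n)).card : ℝ) ≤ (RG (Fin n)).card * (K * ((b * n) ^ 96 * Real.exp (-(b * n)))) := by
  classical
  obtain ⟨lam, hl, w0, hw0, hP⟩ := pot_exists
  set c : ℝ := 3 + 2 * w0 with hc
  set b := lam / 300 with hb
  have hbp : 0 < b := by positivity
  refine ⟨b, 2 * 10 ^ 48 * Real.exp (lam * c) / b ^ 96, hbp, by positivity, ?_⟩
  intro n hn he
  have hlow := simple_lower (V := Fin n) (by simpa using hn) (by simpa using he)
  have hcl := count_lower (V := Fin n)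
  have hbc := bad_count (V := Fin n) hl.le hw0 (hP _)
  simp only [Fintype.card_fin] at hlow hcl hbc
  have hpos : 0 < (RG (Fin n)).card := by
    by_contra h
    have h0 : (RG (Fin n)).card = 0 := by omega
    rw [h0, mul_zero] at hcl
    have h1 : ((Inv (Fin n × Fin 3)).filter (fun σ => DD σ = 0)).card = 0 := by omega
    rw [h1] at hlow
    have := Mf_pos (3 * n)
    omega
  refine ⟨hpos, ?_⟩
  rw [Phi_start w0 n (by omega)] at hbc
  have hM : (Mf (3 * n) : ℝ) ≤ 2 * ((6:ℝ) ^ n * (RG (Fin n)).card * (1 + (3 * n) ^ 2) ^ 48) := by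
    have : Mf (3 * n) ≤ 2 * ((6 ^ n * (RG (Fin n)).card) * (1 + (3 * n) ^ 2) ^ 48) := 
      hlow.trans (Nat.mul_le_mul_left _ (Nat.mul_le_mul_right _ hcl))
    exact_mod_cast this
  have hn1 : (1:ℝ) ≤ n := by exact_mod_cast (by omega : 1 ≤ n)
  have hpoly : (1 + (3 * (n:ℝ)) ^ 2) ^ 48 ≤ 10 ^ 48 * (n:ℝ) ^ 96 := by
    have : (1 + (3 * (n:ℝ)) ^ 2) ≤ 10 * (n:ℝ) ^ 2 := by nlinarith
    calc _ ≤ (10 * (n:ℝ) ^ 2) ^ 48 := by gcongr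
      _ = _ := by rw [mul_pow, ← pow_mul]
  have hexp : Real.exp (lam * (33 / 100 * n + 3 + 2 * w0)) = 
      Real.exp (lam * c) * Real.exp (-(b * n)) * Real.exp (lam * (n / 3)) := by
    rw [← Real.exp_add, ← Real.exp_add]
    congr 1
    rw [hc, hb]; ring
  rw [hexp] at hbc
  have h6 : (0:ℝ) < 6 ^ n := by positivity
  have key : (6:ℝ) ^ n * Real.exp (lam * (n / 3)) * (badG (Fin n)).card ≤ 
    6 ^ n * Real.exp (lam * (n / 3)) * ((RG (Fin n)).card * (2 * 10 ^ 48 * Real.exp (lam * c) / b ^ 96 * ((b * n) ^ 96 * Real.exp (-(b * n))))) := by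
    calc _ = (6:ℝ) ^ n * (badG (Fin n)).card * Real.exp (lam * (n / 3)) := by ring
      _ ≤ _ := hbc
      _ ≤ 2 * ((6:ℝ) ^ n * (RG (Fin n)).card * (10 ^ 48 * (n:ℝ) ^ 96)) * 
          (Real.exp (lam * c) * Real.exp (-(b * n)) * Real.exp (lam * (n / 3))) := by
        gcongr
        refine hM.trans ?_
        gcongr
      _ = _ := by
        rw [mul_pow]
        field_simp
  exact le_of_mul_le_mul_left key (by positivity)

theorem main_tendsto : Filter.Tendsto
      (fun n : ℕ => regularProportion 3 n fun G =>
        zeroForcingNumber G ≤ indepNumber G + 1)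
      (Filter.atTop ⊓ Filter.principal {n : ℕ | Even n}) (nhds 1) := by
  classical
  obtain ⟨b, K, hb, hK, h⟩ := bad_ratio
  have hB : Filter.Tendsto (fun n : ℕ => 1 - K * ((b * (n:ℝ)) ^ 96 * Real.exp (-(b * n)))) Filter.atTop (nhds 1) := by
    have t1 : Filter.Tendsto (fun n : ℕ => b * (n:ℝ)) Filter.atTop Filter.atTop :=
      Filter.Tendsto.const_mul_atTop hb tendsto_natCast_atTop_atTop
    have t2 := (Real.tendsto_pow_mul_exp_neg_atTop_nhds_zero 96).comp t1
    have t3 := (t2.const_mul K).const_sub 1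
    simpa using t3
  have hev : ∀ᶠ n : ℕ in Filter.atTop ⊓ Filter.principal {n : ℕ | Even n}, 30 ≤ n ∧ Even n := by
    rw [Filter.eventually_inf_principal]
    filter_upwards [Filter.eventually_ge_atTop 30] with n hn he
    exact ⟨hn, he⟩
  have hval : ∀ n : ℕ, regularProportion 3 n (fun G => zeroForcingNumber G ≤ indepNumber G + 1)
      = (((RG (Fin n)).filter (fun G => zeroForcingNumber G ≤ indepNumber G + 1)).card : ℝ) / (RG (Fin n)).card := by
    intro n
    unfold regularProportion RG
    rw [Nat.card_eq_fintype_card, Nat.card_eq_fintype_card, Fintype.card_subtype, Fintype.card_subtype,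
      Finset.filter_filter]
    congr!
  have hsplit : ∀ n : ℕ, (((RG (Fin n)).filter (fun G => zeroForcingNumber G ≤ indepNumber G + 1)).card : ℝ) 
      + (badG (Fin n)).card = (RG (Fin n)).card := by
    intro n
    unfold badG
    exact_mod_cast Finset.card_filter_add_card_filter_not (s := RG (Fin n)) _
  refine tendsto_of_tendsto_of_tendsto_of_le_of_le' (hB.mono_left inf_le_left) tendsto_const_nhds ?_ ?_
  · filter_upwards [hev] with n hn
    obtain ⟨h1, h2⟩ := h n hn.1 hn.2
    have h1' : (0:ℝ) < (RG (Fin n)).card := by exact_mod_cast h1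
    rw [hval, le_div_iff₀ h1']
    have := hsplit n
    linarith
  · filter_upwards [hev] with n hn
    obtain ⟨h1, h2⟩ := h n hn.1 hn.2
    have h1' : (0:ℝ) < (RG (Fin n)).card := by exact_mod_cast h1
    rw [hval, div_le_one h1']
    have := hsplit n
    have : (0:ℝ) ≤ (badG (Fin n)).card := by positivity
    linarith

end assembly


end ZFC

/-- A.a.s. (as `n → ∞` along even `n`) a uniformly random simple 3-regular graph `G`
on `n` labelled vertices satisfies `Z(G) ≤ α(G) + 1`. -/
theorem aas_zeroForcing_le_indep_cubic :
    Filter.Tendsto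
      (fun n : ℕ => regularProportion 3 n fun G =>
        zeroForcingNumber G ≤ indepNumber G + 1)
      (Filter.atTop ⊓ Filter.principal {n : ℕ | Even n}) (nhds 1) := by
  exact ZFC.main_tendsto
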